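/- arXiv:math/0106176 — 2 statements merged into one kernel-verified Lean document; each statement's English description precedes it below -/
import Mathlib

section
/- For every δ with 0 < δ ≤ 1, every δ-solution σ_δ has a zero in (1,∞); let U_δ denote the smallest positive zero of σ_δ. Then U_δ is non-increasing in δ: if 0 < δ ≤ η ≤ 1 then U_η ≤ U_δ. Moreover, as δ → 0⁺ one has U_δ · (log log(1/(e^γ·δ)))/(log(1/(e^γ·δ))) → 1. -/
open Finset Filter

/-- `χ_δ(t) = 1` for `0 ≤ t ≤ 1` and `χ_δ(t) = −δ` for `t > 1`. -/
noncomputable def chiDelta (δ : ℝ) (t : ℝ) : ℝ := if t ≤ 1 then 1 else -δ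

/-- `σ` is a `δ`-solution: continuous on `[0,∞)`, equal to `1` on `[0,1]`, and satisfying
`u·σ(u) = ∫_0^u σ(u−t)·χ_δ(t) dt` for `u > 1`. -/
def IsDeltaSolution (δ : ℝ) (σ : ℝ → ℝ) : Prop :=
  ContinuousOn σ (Set.Ici 0) ∧ (∀ u : ℝ, 0 ≤ u → u ≤ 1 → σ u = 1) ∧
    ∀ u : ℝ, 1 < u → u * σ u = ∫ t in (0:ℝ)..u, σ (u - t) * chiDelta δ t

/-- `U` is the smallest positive zero of `σ`. -/
def IsSmallestPosZero (σ : ℝ → ℝ) (U : ℝ) : Prop :=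
  0 < U ∧ σ U = 0 ∧ ∀ v : ℝ, 0 < v → σ v = 0 → U ≤ v

namespace IsDeltaSolution

variable {δ : ℝ} {σ : ℝ → ℝ}

lemma intervalIntegrable (h : IsDeltaSolution δ σ) {a b : ℝ} (ha : 0 ≤ a) (hb : 0 ≤ b) :
    IntervalIntegrable σ MeasureTheory.volume a b :=
  (h.1.mono fun _ hx => (le_inf ha hb).trans hx.1).intervalIntegrable

lemma integral_eq (h : IsDeltaSolution δ σ) {u : ℝ} (hu : 1 < u) :
    u * σ u = (∫ t in (u - 1)..u, σ t) - δ * ∫ t in (0 : ℝ)..(u - 1), σ t := by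
  have h0 : Set.EqOn (fun t => σ (u - t)) (fun t => σ (u - t) * chiDelta δ t) (Set.uIoo 0 1) := by
    intro t ht
    rw [Set.uIoo_of_le zero_le_one] at ht
    simp [chiDelta, ht.2.le]
  have h1 : Set.EqOn (fun t => -δ * σ (u - t)) (fun t => σ (u - t) * chiDelta δ t)
      (Set.uIoo 1 u) := by
    intro t ht
    rw [Set.uIoo_of_le hu.le] at ht
    simp [chiDelta, not_le.2 ht.1, mul_comm]
  have hc : ContinuousOn (fun t => σ (u - t)) (Set.Icc 0 u) :=
    h.1.comp (by fun_prop) fun t ht => sub_nonneg.2 ht.2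
  have i0 : IntervalIntegrable (fun t => σ (u - t)) MeasureTheory.volume 0 1 :=
    ContinuousOn.intervalIntegrable_of_Icc zero_le_one
      (hc.mono (Set.Icc_subset_Icc le_rfl hu.le))
  have i1 : IntervalIntegrable (fun t => -δ * σ (u - t)) MeasureTheory.volume 1 u :=
    ContinuousOn.intervalIntegrable_of_Icc hu.le
      (continuousOn_const.mul (hc.mono (Set.Icc_subset_Icc zero_le_one le_rfl)))
  rw [h.2.2 u hu, ← intervalIntegral.integral_add_adjacent_intervals
    (i0.congr_uIoo h0) (i1.congr_uIoo h1),
    ← intervalIntegral.integral_congr_uIoo h0, ← intervalIntegral.integral_congr_uIoo h1,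
    intervalIntegral.integral_const_mul, intervalIntegral.integral_comp_sub_left,
    intervalIntegral.integral_comp_sub_left]
  simp only [sub_self, sub_zero]
  ring

lemma hasDerivAt_integral (h : IsDeltaSolution δ σ) {u : ℝ} (hu : 0 < u) :
    HasDerivAt (fun x => ∫ t in (0 : ℝ)..x, σ t) (σ u) u :=
  intervalIntegral.integral_hasDerivAt_right (h.intervalIntegrable le_rfl hu.le)
    ((h.1.mono Set.Ioi_subset_Ici_self).stronglyMeasurableAtFilter isOpen_Ioi u hu)
    (h.1.continuousAt (Ici_mem_nhds hu))

lemma hasDerivAt (h : IsDeltaSolution δ σ) {u : ℝ} (hu : 1 < u) :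
    HasDerivAt σ (-(1 + δ) * σ (u - 1) / u) u := by
  have hu0 : u ≠ 0 := by positivity
  have d1 := h.hasDerivAt_integral (zero_lt_one.trans hu)
  have d2 := (h.hasDerivAt_integral (sub_pos.2 hu)).comp_sub_const u 1
  have heq : σ =ᶠ[nhds u] fun x =>
      ((∫ t in (0 : ℝ)..x, σ t) - (1 + δ) * ∫ t in (0 : ℝ)..(x - 1), σ t) / x := by
    filter_upwards [Ioi_mem_nhds hu] with x hx
    have hx' : (1 : ℝ) < x := hx
    have hsplit := intervalIntegral.integral_add_adjacent_intervals
      (h.intervalIntegrable le_rfl (sub_nonneg.2 hx'.le))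
      (h.intervalIntegrable (sub_nonneg.2 hx'.le) (zero_le_one.trans hx'.le))
    rw [eq_div_iff (by positivity), mul_comm, h.integral_eq hx']
    linarith
  have d3 := ((d1.sub (d2.const_mul (1 + δ))).div (hasDerivAt_id u) hu0).congr_of_eventuallyEq heq
  have h2 := heq.self_of_nhds
  refine d3.congr_deriv ?_
  rw [eq_div_iff hu0, mul_comm] at h2
  simp only [id, Pi.sub_apply]
  rw [← h2]
  field_simp
  ring

lemma antitoneOn (h : IsDeltaSolution δ σ) (hδ : 0 ≤ δ) {a : ℝ}
    (hpos : ∀ x, 0 ≤ x → x ≤ a → 0 ≤ σ x) : AntitoneOn σ (Set.Icc 0 a) := by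
  have h1 : AntitoneOn σ (Set.Icc 1 a) := by
    refine antitoneOn_of_deriv_nonpos (convex_Icc 1 a)
      (h.1.mono fun x hx => zero_le_one.trans hx.1) ?_ ?_ <;> rw [interior_Icc]
    · exact fun x hx => (h.hasDerivAt hx.1).differentiableAt.differentiableWithinAt
    · intro x hx
      rw [(h.hasDerivAt hx.1).deriv, neg_mul, neg_div, neg_nonpos]
      have := hpos (x - 1) (by linarith [hx.1]) (by linarith [hx.2])
      have := hx.1
      positivity
  intro x hx y hy hxy
  rcases le_total y 1 with hy1 | hy1
  · rw [h.2.1 x hx.1 (hxy.trans hy1), h.2.1 y hy.1 hy1]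
  rcases le_total x 1 with hx1 | hx1
  · rw [h.2.1 x hx.1 hx1, ← h.2.1 1 zero_le_one le_rfl]
    exact h1 ⟨le_rfl, hy1.trans hy.2⟩ ⟨hy1, hy.2⟩ hy1
  · exact h1 ⟨hx1, hx.2⟩ ⟨hy1, hy.2⟩ hxy

lemma le_one (h : IsDeltaSolution δ σ) (hδ : 0 ≤ δ) {a : ℝ}
    (hpos : ∀ x, 0 ≤ x → x ≤ a → 0 ≤ σ x) {x : ℝ} (hx : 0 ≤ x) (hxa : x ≤ a) : σ x ≤ 1 := by
  rw [← h.2.1 0 le_rfl zero_le_one]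
  exact h.antitoneOn hδ hpos ⟨le_rfl, hx.trans hxa⟩ ⟨hx, hxa⟩ hx

lemma mul_le (h : IsDeltaSolution δ σ) (hδ : 0 ≤ δ) {u : ℝ}
    (hpos : ∀ x, 0 ≤ x → x ≤ u → 0 ≤ σ x) (hu : 1 < u) :
    u * σ u ≤ σ (u - 1) - δ * ∫ t in (0 : ℝ)..(u - 1), σ t := by
  have hu' : 0 ≤ u - 1 := by linarith
  rw [h.integral_eq hu]
  have := intervalIntegral.integral_mono_on (sub_le_self u zero_le_one)
    (h.intervalIntegrable hu' (by linarith)) intervalIntegrable_const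
    (fun t ht => h.antitoneOn hδ hpos ⟨hu', by linarith⟩ ⟨hu'.trans ht.1, ht.2⟩ ht.1)
  simp only [intervalIntegral.integral_const, sub_sub_cancel, one_smul] at this
  linarith

lemma mul_le_sub (h : IsDeltaSolution δ σ) (hδ : 0 ≤ δ) {u : ℝ}
    (hpos : ∀ x, 0 ≤ x → x ≤ u → 0 ≤ σ x) (hu : 2 ≤ u) :
    u * σ u ≤ σ (u - 1) - δ := by
  refine (h.mul_le hδ hpos (by linarith)).trans (sub_le_sub_left ?_ _)
  have h1 : ∫ t in (0 : ℝ)..1, σ t = 1 := by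
    rw [intervalIntegral.integral_congr (g := fun _ => (1 : ℝ))]
    · simp
    · intro t ht
      rw [Set.uIcc_of_le zero_le_one] at ht
      exact h.2.1 t ht.1 ht.2
  rw [← intervalIntegral.integral_add_adjacent_intervals
    (h.intervalIntegrable le_rfl zero_le_one)
    (h.intervalIntegrable zero_le_one (by linarith)), h1]
  have : 0 ≤ ∫ t in (1 : ℝ)..(u - 1), σ t :=
    intervalIntegral.integral_nonneg (by linarith)
      fun t ht => hpos t (zero_le_one.trans ht.1) (by linarith [ht.2])
  nlinarith

lemma pos_of_forall_ne_zero (h : IsDeltaSolution δ σ) {x : ℝ} (hx : 0 ≤ x)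
    (hne : ∀ y, 1 < y → y ≤ x → σ y ≠ 0) : 0 < σ x := by
  rcases le_or_gt x 1 with hx1 | hx1
  · rw [h.2.1 x hx hx1]
    exact one_pos
  by_contra! hneg
  obtain ⟨y, hy, hy0⟩ := intermediate_value_Icc' hx1.le
    (h.1.mono fun z hz => zero_le_one.trans hz.1)
    (show (0 : ℝ) ∈ Set.Icc (σ x) (σ 1) from ⟨hneg, by simp [h.2.1 1 zero_le_one le_rfl]⟩)
  refine hne y (hy.1.lt_of_ne fun h1 => ?_) hy.2 hy0
  rw [← h1, h.2.1 1 zero_le_one le_rfl] at hy0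
  exact one_ne_zero hy0

lemma exists_zero (h : IsDeltaSolution δ σ) (hδ : 0 < δ) : ∃ u, 1 < u ∧ σ u = 0 := by
  by_contra! hne
  have hpos : ∀ x, 0 ≤ x → 0 < σ x := fun x hx =>
    h.pos_of_forall_ne_zero hx fun y hy _ => hne y hy
  have hinv := inv_pos.2 hδ
  set v := δ⁻¹ + 1 with hv
  have h0 : ∀ a : ℝ, ∀ x, 0 ≤ x → x ≤ a → 0 ≤ σ x := fun a x hx _ => (hpos x hx).le
  have h1 := h.mul_le_sub hδ.le (h0 (v + 1)) (by linarith)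
  have h2 := h.mul_le hδ.le (h0 v) (by linarith)
  have h3 : 0 ≤ ∫ t in (0 : ℝ)..(v - 1), σ t :=
    intervalIntegral.integral_nonneg (by linarith) fun t ht => (hpos t ht.1).le
  have h4 := h.le_one hδ.le (h0 v) (x := v - 1) (by linarith) (by linarith)
  have h5 := hpos (v + 1) (by linarith)
  rw [add_sub_cancel_right] at h1
  have h6 : δ < σ v := by nlinarith
  have h7 : v * σ v ≤ 1 := by nlinarith
  have h8 : v * δ = 1 + δ := by rw [hv]; field_simp
  nlinarith

lemma eqOn {τ : ℝ → ℝ} (h : IsDeltaSolution δ σ) (h' : IsDeltaSolution δ τ) {u : ℝ}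
    (hu : 0 ≤ u) : σ u = τ u := by
  have key : ∀ n : ℕ, ∀ x : ℝ, 0 ≤ x → x ≤ n + 1 → σ x = τ x := by
    intro n
    induction n with
    | zero =>
      intro x hx hx1
      rw [Nat.cast_zero, zero_add] at hx1
      rw [h.2.1 x hx hx1, h'.2.1 x hx hx1]
    | succ n ih =>
      intro x hx hxn
      rcases le_or_gt x (n + 1) with hx1 | hx1
      · exact ih x hx hx1
      have hn : (0 : ℝ) ≤ n := n.cast_nonneg
      obtain ⟨c, hc, hslope⟩ := exists_hasDerivAt_eq_slope (σ - τ)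
        (fun y => -(1 + δ) * σ (y - 1) / y - -(1 + δ) * τ (y - 1) / y) hx1
        ((h.1.sub h'.1).mono fun y hy => by simp only [Set.mem_Ici]; linarith [hy.1])
        (fun y hy => (h.hasDerivAt (by linarith [hy.1])).sub (h'.hasDerivAt (by linarith [hy.1])))
      push_cast at hxn
      rw [ih (c - 1) (by linarith [hc.1]) (by linarith [hc.2]), sub_self, eq_comm,
        div_eq_zero_iff, or_iff_left (by linarith), Pi.sub_apply, Pi.sub_apply,
        ih (n + 1) (by positivity) le_rfl, sub_self, sub_zero] at hslope
      linarith
  exact key ⌊u⌋₊ u hu (Nat.lt_floor_add_one u).le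

end IsDeltaSolution

namespace IsSmallestPosZero

variable {δ η U V : ℝ} {σ τ : ℝ → ℝ}

lemma one_lt (hU : IsSmallestPosZero σ U) (h : IsDeltaSolution δ σ) : 1 < U := by
  by_contra! hle
  have := hU.2.1
  rw [h.2.1 U hU.1.le hle] at this
  exact one_ne_zero this

lemma pos_of_lt (hU : IsSmallestPosZero σ U) (h : IsDeltaSolution δ σ) {x : ℝ} (hx : 0 ≤ x)
    (hxU : x < U) : 0 < σ x :=
  h.pos_of_forall_ne_zero hx fun y hy hyx hy0 =>
    absurd (hU.2.2 y (zero_lt_one.trans hy) hy0) (not_le.2 (hyx.trans_lt hxU))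

lemma nonneg_of_le (hU : IsSmallestPosZero σ U) (h : IsDeltaSolution δ σ) (x : ℝ) (hx : 0 ≤ x)
    (hxU : x ≤ U) : 0 ≤ σ x := by
  rcases hxU.eq_or_lt with rfl | hlt
  · exact hU.2.1.ge
  · exact (hU.pos_of_lt h hx hlt).le

lemma le_of_lt_param (hδ : 0 < δ) (hδη : δ < η) (hσ : IsDeltaSolution δ σ)
    (hτ : IsDeltaSolution η τ) (hU : IsSmallestPosZero σ U) (hV : IsSmallestPosZero τ V) :
    V ≤ U := by
  by_contra! hUV
  have hU1 := hU.one_lt hσ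
  have hτpos : ∀ x, 0 ≤ x → x ≤ U → 0 < τ x := fun x hx hxU =>
    hV.pos_of_lt hτ hx (hxU.trans_lt hUV)
  set φ : ℝ → ℝ := fun u => (1 + η) * (σ u * τ (u - 1)) - (1 + δ) * (σ (u - 1) * τ u) with hφ
  have hmaps : Set.MapsTo (fun u : ℝ => u - 1) (Set.Icc 1 U) (Set.Ici 0) := fun u hu =>
    sub_nonneg.2 hu.1
  have hsub : Set.Icc 1 U ⊆ Set.Ici 0 := fun u hu => zero_le_one.trans hu.1
  have hσ' : ContinuousOn (fun u => σ (u - 1)) (Set.Icc 1 U) := hσ.1.comp (by fun_prop) hmaps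
  have hτ' : ContinuousOn (fun u => τ (u - 1)) (Set.Icc 1 U) := hτ.1.comp (by fun_prop) hmaps
  have hcont : ContinuousOn φ (Set.Icc 1 U) :=
    (continuousOn_const.mul ((hσ.1.mono hsub).mul hτ')).sub
      (continuousOn_const.mul (hσ'.mul (hτ.1.mono hsub)))
  have hcompact : IsCompact (Set.Icc 1 U ∩ φ ⁻¹' Set.Iic 0) :=
    isCompact_Icc.of_isClosed_subset (hcont.preimage_isClosed_of_isClosed isClosed_Icc isClosed_Iic)
      Set.inter_subset_left
  have hφU : φ U ≤ 0 := by
    have := hU.pos_of_lt hσ (x := U - 1) (by linarith) (by linarith)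
    have := hτpos U (by linarith) le_rfl
    simp only [hφ, hU.2.1, zero_mul, mul_zero, zero_sub, neg_nonpos]
    positivity
  obtain ⟨w, ⟨hw, hφw⟩, hmin⟩ := hcompact.exists_isLeast ⟨U, ⟨hU1.le, le_rfl⟩, hφU⟩
  have hφpos : ∀ u, 1 ≤ u → u < w → 0 < φ u := fun u hu huw => by
    by_contra! hle
    exact absurd (hmin ⟨⟨hu, huw.le.trans hw.2⟩, hle⟩) (not_le.2 huw)
  have hmono : MonotoneOn (fun u => σ u / τ u) (Set.Icc 1 w) := by
    refine monotoneOn_of_deriv_nonneg (convex_Icc 1 w) ?_ ?_ ?_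
    · exact (hσ.1.mono fun u hu => zero_le_one.trans hu.1).div
        (hτ.1.mono fun u hu => zero_le_one.trans hu.1)
        fun u hu => (hτpos u (zero_le_one.trans hu.1) (hu.2.trans hw.2)).ne'
    all_goals
      rw [interior_Icc]
      intro u hu
      have hτu := hτpos u (zero_le_one.trans hu.1.le) (hu.2.le.trans hw.2)
      have hd := (hσ.hasDerivAt hu.1).div (hτ.hasDerivAt hu.1) hτu.ne'
    · exact hd.differentiableAt.differentiableWithinAt
    · rw [show (fun u => σ u / τ u) = σ / τ from rfl, hd.deriv]
      have hu0 : 0 < u := zero_lt_one.trans hu.1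
      refine div_nonneg ?_ (sq_nonneg _)
      rw [show -(1 + δ) * σ (u - 1) / u * τ u - σ u * (-(1 + η) * τ (u - 1) / u) = φ u / u by
        simp only [hφ]; field_simp; ring]
      exact div_nonneg (hφpos u hu.1.le hu.2).le hu0.le
  have hratio : σ (w - 1) / τ (w - 1) ≤ σ w / τ w := by
    rcases le_total (w - 1) 1 with hw1 | hw1
    · rw [hσ.2.1 _ (sub_nonneg.2 hw.1) hw1, hτ.2.1 _ (sub_nonneg.2 hw.1) hw1]
      simpa [hσ.2.1 1 zero_le_one le_rfl, hτ.2.1 1 zero_le_one le_rfl] using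
        hmono ⟨le_rfl, hw.1⟩ ⟨hw.1, le_rfl⟩ hw.1
    · exact hmono ⟨hw1, by linarith⟩ ⟨hw.1, le_rfl⟩ (by linarith)
  have hτw := hτpos w (zero_le_one.trans hw.1) hw.2
  rw [div_le_div_iff₀ (hτpos _ (sub_nonneg.2 hw.1) (by linarith [hw.2])) hτw] at hratio
  have hσw := hU.pos_of_lt hσ (x := w - 1) (sub_nonneg.2 hw.1) (by linarith [hw.2])
  have hφw' : (1 + η) * (σ w * τ (w - 1)) - (1 + δ) * (σ (w - 1) * τ w) ≤ 0 := hφw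
  nlinarith [mul_pos hσw hτw, mul_pos (sub_pos.2 hδη) (mul_pos hσw hτw)]

lemma le_of_le_param (hδ : 0 < δ) (hδη : δ ≤ η) (hσ : IsDeltaSolution δ σ)
    (hτ : IsDeltaSolution η τ) (hU : IsSmallestPosZero σ U) (hV : IsSmallestPosZero τ V) :
    V ≤ U := by
  rcases hδη.eq_or_lt with rfl | hlt
  · exact hV.2.2 U hU.1 ((hτ.eqOn hσ hU.1.le).trans hU.2.1)
  · exact le_of_lt_param hδ hlt hσ hτ hU hV

lemma mul_factorial_le_one (hU : IsSmallestPosZero σ U) (h : IsDeltaSolution δ σ) (hδ : 0 < δ)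
    (hδ1 : δ ≤ 1) {n : ℕ} (hn : n + 1 ≤ U) : δ * n.factorial ≤ 1 := by
  have key : ∀ m : ℕ, (m : ℝ) ≤ U → σ m * m.factorial ≤ 1 := by
    intro m
    induction m with
    | zero => intro _; simp [h.2.1 0 le_rfl zero_le_one]
    | succ m ih =>
      intro hm
      push_cast at hm ⊢
      have ih := ih (by linarith)
      rcases m.eq_zero_or_pos with rfl | hm0
      · simp [h.2.1 1 zero_le_one le_rfl]
      have hm1 : (1 : ℝ) ≤ m := by exact_mod_cast hm0
      have h2 := h.mul_le_sub hδ.le (u := m + 1)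
        (fun x hx hxm => hU.nonneg_of_le h x hx (hxm.trans hm)) (by linarith)
      rw [add_sub_cancel_right] at h2
      have h3 : (0 : ℝ) < m.factorial := by exact_mod_cast m.factorial_pos
      rw [Nat.factorial_succ]
      push_cast
      nlinarith
  rcases n.eq_zero_or_pos with rfl | hn0
  · simpa using hδ1
  have hn1 : (1 : ℝ) ≤ n := by exact_mod_cast hn0
  have h2 := h.mul_le_sub hδ.le (u := n + 1)
    (fun x hx hxm => hU.nonneg_of_le h x hx (hxm.trans hn)) (by linarith)
  rw [add_sub_cancel_right] at h2
  have h3 : (0 : ℝ) < n.factorial := by exact_mod_cast n.factorial_pos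
  have h4 := hU.nonneg_of_le h (n + 1) (by linarith) hn
  have h5 : δ ≤ σ n := by nlinarith
  exact (mul_le_mul_of_nonneg_right h5 h3.le).trans (key n (by linarith))

lemma pow_sub_le (hU : IsSmallestPosZero σ U) (h : IsDeltaSolution δ σ) (hδ : 0 < δ) {s : ℝ}
    (hs0 : 0 < s) (hs1 : s < 1) (k : ℕ) :
    ∀ u, 0 ≤ u → u ≤ U → u ≤ 1 + k * s → ((1 - s) / U) ^ k - k * δ ≤ σ u := by
  have hU1 := hU.one_lt h
  have hq0 : 0 < (1 - s) / U := div_pos (by linarith) (by linarith)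
  have hq1 : (1 - s) / U ≤ 1 := by rw [div_le_one (by linarith)]; linarith
  induction k with
  | zero =>
    intro u hu _ hu1
    simp [h.2.1 u hu (by simpa using hu1)]
  | succ k ih =>
    intro u hu huU huk
    have hkδ : 0 ≤ (k : ℝ) * δ := by positivity
    push_cast at huk ⊢
    rcases le_or_gt u 1 with hu1 | hu1
    · rw [h.2.1 u hu hu1]
      have := pow_le_one₀ hq0.le hq1 (n := k + 1)
      linarith
    have hpos : ∀ x, 0 ≤ x → x ≤ u → 0 ≤ σ x := fun x hx hxu =>
      hU.nonneg_of_le h x hx (hxu.trans huU)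
    have hanti := h.antitoneOn hδ.le hpos
    have hih := ih (u - s) (by linarith) (by linarith) (by linarith)
    have hI1 : (1 - s) * σ (u - s) ≤ ∫ t in (u - 1)..(u - s), σ t := by
      have := intervalIntegral.integral_mono_on (by linarith : u - 1 ≤ u - s)
        intervalIntegrable_const (h.intervalIntegrable (by linarith) (by linarith))
        (fun t ht => hanti ⟨by linarith [ht.1], by linarith [ht.2]⟩
          ⟨by linarith, by linarith⟩ ht.2)
      simp only [intervalIntegral.integral_const, smul_eq_mul] at this
      linarith
    have hI2 : 0 ≤ ∫ t in (u - s)..u, σ t :=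
      intervalIntegral.integral_nonneg (by linarith)
        fun t ht => hpos t (by linarith [ht.1]) ht.2
    have hI3 : ∫ t in (0 : ℝ)..(u - 1), σ t ≤ u - 1 := by
      have := intervalIntegral.integral_mono_on (by linarith : 0 ≤ u - 1)
        (h.intervalIntegrable le_rfl (by linarith)) intervalIntegrable_const
        (fun t ht => h.le_one hδ.le hpos ht.1 (by linarith [ht.2]))
      simpa using this
    have hsplit := intervalIntegral.integral_add_adjacent_intervals
      (h.intervalIntegrable (a := u - 1) (b := u - s) (by linarith) (by linarith))
      (h.intervalIntegrable (a := u - s) (b := u) (by linarith) (by linarith))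
    have heq := h.integral_eq hu1
    have h1 : (1 - s) * σ (u - s) - δ * u ≤ u * σ u := by nlinarith
    have hσs := hpos (u - s) (by linarith) (by linarith)
    have h2 : (1 - s) / U * σ (u - s) ≤ (1 - s) / u * σ (u - s) :=
      mul_le_mul_of_nonneg_right
        (div_le_div_of_nonneg_left (by linarith) (by linarith) huU) hσs
    have h3 : (1 - s) / u * σ (u - s) - δ ≤ σ u := by
      have hu0 : 0 < u := by linarith
      rw [← mul_le_mul_iff_right₀ hu0]
      calc u * ((1 - s) / u * σ (u - s) - δ) = (1 - s) * σ (u - s) - δ * u := by field_simp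
        _ ≤ _ := h1
    have h4 := mul_le_mul_of_nonneg_left hih hq0.le
    rw [pow_succ]
    nlinarith

lemma neg_log_le (hU : IsSmallestPosZero σ U) (h : IsDeltaSolution δ σ) (hδ : 0 < δ) {s : ℝ}
    (hs0 : 0 < s) (hs1 : s < 1) :
    -Real.log δ ≤ Real.log (U / s + 1) + (U / s + 1) * (Real.log U - Real.log (1 - s)) := by
  have hU1 := hU.one_lt h
  have hUs : 0 < U / s := by positivity
  set k := ⌈U / s⌉₊ with hk
  have hk1 : (k : ℝ) ≤ U / s + 1 := (Nat.ceil_lt_add_one hUs.le).le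
  have hk0 : U / s ≤ k := Nat.le_ceil _
  have hkpos : (0 : ℝ) < k := hUs.trans_le hk0
  have hq0 : 0 < (1 - s) / U := div_pos (by linarith) (by linarith)
  have hUk : U ≤ k * s := (div_le_iff₀ hs0).1 hk0
  have hle := hU.pow_sub_le h hδ hs0 hs1 k U (by linarith) le_rfl (by linarith)
  rw [hU.2.1, sub_nonpos] at hle
  have hlog := Real.log_le_log (by positivity) hle
  rw [Real.log_pow, Real.log_div (by linarith) (by linarith),
    Real.log_mul hkpos.ne' hδ.ne'] at hlog
  have h1 : Real.log k ≤ Real.log (U / s + 1) := Real.log_le_log hkpos hk1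
  have h2 : 0 ≤ Real.log U - Real.log (1 - s) := by
    linarith [Real.log_nonneg hU1.le, Real.log_nonpos (x := 1 - s) (by linarith) (by linarith)]
  nlinarith [mul_le_mul_of_nonneg_right hk1 h2]

lemma le_neg_log (hU : IsSmallestPosZero σ U) (h : IsDeltaSolution δ σ) (hδ : 0 < δ)
    (hδ1 : δ ≤ 1) (hU2 : 3 ≤ U) :
    (U - 2) * Real.log (U - 2) - U ≤ -Real.log δ := by
  obtain ⟨n, hn⟩ : ∃ n, ⌊U⌋₊ = n + 1 :=
    Nat.exists_eq_succ_of_ne_zero (Nat.floor_pos.2 (by linarith)).ne'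
  have hn1 : (n : ℝ) + 1 ≤ U := by exact_mod_cast hn ▸ Nat.floor_le hU.1.le
  have hn2 : U < n + 1 + 1 := by exact_mod_cast hn ▸ Nat.lt_floor_add_one U
  have hn0 : n ≠ 0 := by
    rintro rfl
    norm_num at hn2
    linarith
  have hfac := hU.mul_factorial_le_one h hδ hδ1 hn1
  have hfpos : (0 : ℝ) < n.factorial := by exact_mod_cast n.factorial_pos
  have hlog := Real.log_nonpos (by positivity) hfac
  rw [Real.log_mul hδ.ne' hfpos.ne'] at hlog
  have hst := Stirling.le_log_factorial_stirling hn0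
  have h1n : (1 : ℝ) ≤ n := by exact_mod_cast Nat.one_le_iff_ne_zero.2 hn0
  have h1 : 0 ≤ Real.log n := Real.log_nonneg h1n
  have h2 : 0 ≤ Real.log (2 * Real.pi) := Real.log_nonneg (by linarith [Real.two_le_pi])
  have h3 : (U - 2) * Real.log (U - 2) ≤ n * Real.log n :=
    mul_le_mul (by linarith) (Real.log_le_log (by linarith) (by linarith))
      (Real.log_nonneg (by linarith)) (by linarith)
  linarith

end IsSmallestPosZero

section Asymptotics

open Topology Asymptotics

lemma tendsto_inv_log_atTop : Tendsto (fun x : ℝ => (Real.log x)⁻¹) atTop (𝓝 0) :=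
  Real.tendsto_log_atTop.inv_tendsto_atTop

lemma tendsto_log_sub_two_div_log :
    Tendsto (fun x : ℝ => Real.log (x - 2) / Real.log x) atTop (𝓝 1) := by
  have h1 : Tendsto (fun x : ℝ => Real.log (1 - 2 * x⁻¹)) atTop (𝓝 0) := by
    have h : Tendsto (fun x : ℝ => 1 - 2 * x⁻¹) atTop (𝓝 1) := by
      simpa using tendsto_const_nhds.sub (tendsto_inv_atTop_zero.const_mul (2 : ℝ))
    simpa using h.log one_ne_zero
  have h2 : Tendsto (fun x : ℝ => 1 + Real.log (1 - 2 * x⁻¹) * (Real.log x)⁻¹) atTop (𝓝 1) := by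
    simpa using tendsto_const_nhds.add (h1.mul tendsto_inv_log_atTop)
  refine h2.congr' ?_
  filter_upwards [eventually_gt_atTop 3] with x hx
  have hlog : 0 < Real.log x := Real.log_pos (by linarith)
  have hx0 : 0 < x := by linarith
  have hsub : 1 - 2 * x⁻¹ = (x - 2) / x := by field_simp
  rw [hsub, Real.log_div (by linarith) hx0.ne']
  field_simp
  ring

lemma tendsto_lower_div_mul_log :
    Tendsto (fun x : ℝ => ((x - 2) * Real.log (x - 2) - x) / (x * Real.log x)) atTop (𝓝 1) := by
  have h : Tendsto (fun x : ℝ => (1 - 2 * x⁻¹) * (Real.log (x - 2) / Real.log x) - (Real.log x)⁻¹)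
      atTop (𝓝 1) := by
    simpa using ((tendsto_const_nhds.sub (tendsto_inv_atTop_zero.const_mul (2 : ℝ))).mul
      tendsto_log_sub_two_div_log).sub tendsto_inv_log_atTop
  refine h.congr' ?_
  filter_upwards [eventually_gt_atTop 1] with x hx
  have hlog : 0 < Real.log x := Real.log_pos hx
  field_simp

lemma tendsto_upper_div_mul_log {s : ℝ} (hs : 0 < s) (c : ℝ) :
    Tendsto (fun x : ℝ => (Real.log (x / s + 1) + (x / s + 1) * (Real.log x - c)) /
      (x * Real.log x)) atTop (𝓝 s⁻¹) := by
  have h1 : Tendsto (fun x : ℝ => Real.log (x / s + 1) / (x * Real.log x)) atTop (𝓝 0) := by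
    refine squeeze_zero' (g := fun x => s⁻¹ * (Real.log x)⁻¹) ?_ ?_
      (by simpa using tendsto_inv_log_atTop.const_mul s⁻¹) <;>
    filter_upwards [eventually_gt_atTop 1] with x hx
    all_goals
      have hlog : 0 < Real.log x := Real.log_pos hx
      have hxs : 0 < x / s := by positivity
    · exact div_nonneg (Real.log_nonneg (by linarith)) (by positivity)
    · rw [div_le_iff₀ (by positivity)]
      have := Real.log_le_sub_one_of_pos (x := x / s + 1) (by linarith)
      calc _ ≤ x / s := by linarith
        _ = _ := by field_simp
  have h2 : Tendsto (fun x : ℝ => Real.log (x / s + 1) / (x * Real.log x) +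
      (s⁻¹ + x⁻¹) * (1 - c * (Real.log x)⁻¹)) atTop (𝓝 s⁻¹) := by
    simpa using h1.add ((tendsto_inv_atTop_zero.const_add s⁻¹).mul
      ((tendsto_inv_log_atTop.const_mul c).const_sub 1))
  refine h2.congr' ?_
  filter_upwards [eventually_gt_atTop 1] with x hx
  have hlog : 0 < Real.log x := Real.log_pos hx
  field_simp

/-- If `L ~ U log U` with `U → ∞`, then `U ~ L / log L`, even after shifting `L` by a constant. -/
lemma tendsto_mul_log_div {α : Type*} {l : Filter α} {U L : α → ℝ} (hU : Tendsto U l atTop)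
    (hL : Tendsto (fun a => L a / (U a * Real.log (U a))) l (𝓝 1)) (c : ℝ) :
    Tendsto (fun a => U a * Real.log (L a - c) / (L a - c)) l (𝓝 1) := by
  have hlog : Tendsto (fun a => Real.log (U a)) l atTop := Real.tendsto_log_atTop.comp hU
  have hq : Tendsto (fun a => (L a - c) / (U a * Real.log (U a))) l (𝓝 1) := by
    have := hL.sub (((hU.atTop_mul_atTop₀ hlog).inv_tendsto_atTop).const_mul c)
    simp only [mul_zero, sub_zero] at this
    refine this.congr fun a => ?_
    simp only [Pi.inv_apply]
    ring
  have hlogq : Tendsto (fun a => Real.log ((L a - c) / (U a * Real.log (U a)))) l (𝓝 0) := by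
    simpa using hq.log one_ne_zero
  have hll : Tendsto (fun a => Real.log (Real.log (U a)) / Real.log (U a)) l (𝓝 0) :=
    (Real.isLittleO_log_id_atTop.tendsto_div_nhds_zero).comp hlog
  have hr : Tendsto (fun a => Real.log ((L a - c) / (U a * Real.log (U a))) *
      (Real.log (U a))⁻¹ + 1 + Real.log (Real.log (U a)) / Real.log (U a)) l (𝓝 1) := by
    simpa using ((hlogq.mul hlog.inv_tendsto_atTop).add_const 1).add hll
  have hfin := hr.div hq one_ne_zero
  rw [div_one] at hfin
  refine hfin.congr' ?_
  filter_upwards [hU.eventually_gt_atTop 1, hq.eventually_const_lt one_half_lt_one] with a hU1 hqa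
  have hl : 0 < Real.log (U a) := Real.log_pos hU1
  have hden : 0 < U a * Real.log (U a) := by positivity
  have hnum : 0 < L a - c := by
    by_contra! hneg
    linarith [div_nonpos_of_nonpos_of_nonneg hneg hden.le]
  simp only [Pi.div_apply]
  rw [Real.log_div hnum.ne' hden.ne', Real.log_mul (by linarith) hl.ne']
  field_simp
  ring

lemma tendsto_smallest_zero_atTop {σ : ℝ → ℝ → ℝ} {U : ℝ → ℝ}
    (h : ∀ δ, 0 < δ → δ ≤ 1 → IsDeltaSolution δ (σ δ) ∧ IsSmallestPosZero (σ δ) (U δ)) :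
    Tendsto U (𝓝[>] 0) atTop := by
  have hneg : Tendsto (fun δ => -Real.log δ) (𝓝[>] 0) atTop :=
    tendsto_neg_atBot_atTop.comp Real.tendsto_log_nhdsGT_zero
  refine tendsto_atTop.2 fun M => ?_
  filter_upwards [hneg.eventually_gt_atTop (8 * M ^ 2), Ioc_mem_nhdsGT zero_lt_one]
    with δ hδM hδ
  obtain ⟨hσ, hU⟩ := h δ hδ.1 hδ.2
  have hU1 := hU.one_lt hσ
  have hle := hU.neg_log_le hσ hδ.1 (s := 1 / 2) (by norm_num) (by norm_num)
  have h1 := Real.log_le_sub_one_of_pos (x := U δ / (1 / 2) + 1) (by linarith)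
  have h2 := Real.log_le_sub_one_of_pos hU.1
  have h3 : -Real.log (1 - 1 / 2) ≤ 1 := by
    rw [← Real.log_inv]
    exact (Real.log_le_sub_one_of_pos (by norm_num)).trans (by norm_num)
  have h4 : (U δ / (1 / 2) + 1) * (Real.log (U δ) - Real.log (1 - 1 / 2)) ≤
      (U δ / (1 / 2) + 1) * U δ := mul_le_mul_of_nonneg_left (by linarith) (by linarith)
  by_contra! hlt
  nlinarith

lemma tendsto_neg_log_div_smallest_zero {σ : ℝ → ℝ → ℝ} {U : ℝ → ℝ}
    (h : ∀ δ, 0 < δ → δ ≤ 1 → IsDeltaSolution δ (σ δ) ∧ IsSmallestPosZero (σ δ) (U δ)) :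
    Tendsto (fun δ => -Real.log δ / (U δ * Real.log (U δ))) (𝓝[>] 0) (𝓝 1) := by
  have hUtop := tendsto_smallest_zero_atTop h
  refine tendsto_order.2 ⟨fun a ha => ?_, fun b hb => ?_⟩
  · filter_upwards [(tendsto_lower_div_mul_log.comp hUtop).eventually_const_lt ha,
      hUtop.eventually_ge_atTop 3, Ioc_mem_nhdsGT zero_lt_one] with δ hlow hU3 hδ
    obtain ⟨hσ, hU⟩ := h δ hδ.1 hδ.2
    have hlog : 0 < Real.log (U δ) := Real.log_pos (by linarith)
    exact hlow.trans_le (div_le_div_of_nonneg_right (hU.le_neg_log hσ hδ.1 hδ.2 hU3)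
      (mul_pos hU.1 hlog).le)
  · obtain ⟨s, hs, hs1⟩ := exists_between (inv_lt_one_of_one_lt₀ hb)
    have hb0 : 0 < b := one_pos.trans hb
    have hs0 : 0 < s := (inv_pos.2 hb0).trans hs
    filter_upwards [((tendsto_upper_div_mul_log hs0 (Real.log (1 - s))).comp
      hUtop).eventually_lt_const (inv_lt_of_inv_lt₀ hb0 hs), Ioc_mem_nhdsGT zero_lt_one]
      with δ hup hδ
    obtain ⟨hσ, hU⟩ := h δ hδ.1 hδ.2
    have hlog : 0 < Real.log (U δ) := Real.log_pos (hU.one_lt hσ)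
    exact (div_le_div_of_nonneg_right (hU.neg_log_le hσ hδ.1 hs0 hs1)
      (mul_pos hU.1 hlog).le).trans_lt hup

end Asymptotics

theorem prop2_zeros :
    (∀ δ : ℝ, 0 < δ → δ ≤ 1 → ∀ σ : ℝ → ℝ, IsDeltaSolution δ σ →
      ∃ u : ℝ, 1 < u ∧ σ u = 0) ∧
    (∀ δ η : ℝ, 0 < δ → δ ≤ η → η ≤ 1 →
      ∀ σδ ση : ℝ → ℝ, IsDeltaSolution δ σδ → IsDeltaSolution η ση →
      ∀ Uδ Uη : ℝ, IsSmallestPosZero σδ Uδ → IsSmallestPosZero ση Uη → Uη ≤ Uδ) ∧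
    (∀ σ : ℝ → ℝ → ℝ, ∀ U : ℝ → ℝ,
      (∀ δ : ℝ, 0 < δ → δ ≤ 1 →
        IsDeltaSolution δ (σ δ) ∧ IsSmallestPosZero (σ δ) (U δ)) →
      Tendsto (fun δ : ℝ =>
          U δ * Real.log (Real.log (1 / (Real.exp Real.eulerMascheroniConstant * δ)))
            / Real.log (1 / (Real.exp Real.eulerMascheroniConstant * δ)))
        (nhdsWithin 0 (Set.Ioi 0)) (nhds 1)) := by
  refine ⟨fun δ hδ _ σ h => h.exists_zero hδ, ?_, ?_⟩
  · intro δ η hδ hδη _ σδ ση hσδ hση Uδ Uη hUδ hUη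
    exact IsSmallestPosZero.le_of_le_param hδ hδη hσδ hση hUδ hUη
  · intro σ U h
    refine (tendsto_mul_log_div (tendsto_smallest_zero_atTop h)
      (tendsto_neg_log_div_smallest_zero h) Real.eulerMascheroniConstant).congr' ?_
    filter_upwards [self_mem_nhdsWithin] with δ hδ
    have hδ0 : (0 : ℝ) < δ := hδ
    rw [one_div, Real.log_inv, Real.log_mul (Real.exp_pos _).ne' hδ0.ne', Real.log_exp, neg_add,
      neg_add_eq_sub]
end

section
/- Let 0 < δ ≤ 1, let σ_δ be a δ-solution, and suppose σ_δ has a smallest positive zero U_δ. Then there exist a measurable function χ : [0,∞) → [−δ, 1] and a continuous function σ : [0,∞) → ℝ such that: χ(t) = 1 for 0 ≤ t ≤ 1; χ(t) = −δ for 1 < t ≤ U_δ; χ is continuous on (U_δ, ∞); σ(u) = 1 for 0 ≤ u ≤ 1 and u·σ(u) = ∫_0^u σ(u−t)·χ(t) dt for all u > 1; σ(u) = σ_δ(u) for 0 ≤ u ≤ U_δ; and σ(u) = 0 for all u ≥ U_δ. Moreover there exist constants C > 0 and δ_0 > 0 such that for all 0 < δ ≤ δ_0, | (1/U_δ)·∫_0^{U_δ}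 σ_δ(t) dt − e^γ/U_δ | ≤ C·δ. -/
open Finset

open MeasureTheory intervalIntegral Filter Topology

/-- The integrated form of the defining equation of a `δ`-solution. -/
lemma IsDeltaSolution.mul_eq {δ : ℝ} {σ : ℝ → ℝ} (h : IsDeltaSolution δ σ) {u : ℝ} (hu : 1 ≤ u) :
    u * σ u = (∫ t in (0:ℝ)..u, σ t) - (1 + δ) * ∫ t in (0:ℝ)..(u - 1), σ t := by
  obtain ⟨hc, h1, he⟩ := h
  have hint : ∀ a b : ℝ, 0 ≤ a → 0 ≤ b → IntervalIntegrable σ volume a b := fun a b ha hb =>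
    (hc.mono fun x hx => (le_min ha hb).trans hx.1).intervalIntegrable
  rcases hu.eq_or_lt with rfl | hu
  · have : ∫ t in (0:ℝ)..1, σ t = ∫ t in (0:ℝ)..1, (1:ℝ) := by
      refine integral_congr fun t ht => ?_
      rw [Set.uIcc_of_le zero_le_one] at ht
      exact h1 t ht.1 ht.2
    simp [this, h1]
  · rw [he u hu]
    have e1 : ∀ t ∈ Set.uIoc 0 1, σ (u - t) = σ (u - t) * chiDelta δ t := by
      intro t ht
      rw [Set.uIoc_of_le zero_le_one] at ht
      simp [chiDelta, ht.2]
    have e2 : ∀ t ∈ Set.uIoc 1 u, σ (u - t) * (-δ) = σ (u - t) * chiDelta δ t := by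
      intro t ht
      rw [Set.uIoc_of_le hu.le] at ht
      simp [chiDelta, ht.1]
    have i1 : IntervalIntegrable (fun t => σ (u - t)) volume 0 1 := by
      have := (hint (u - 1) (u - 0) (by linarith) (by linarith)).comp_sub_left u
      simpa using this.symm
    have i2 : IntervalIntegrable (fun t => σ (u - t)) volume 1 u := by
      have := (hint (u - u) (u - 1) (by linarith) (by linarith)).comp_sub_left u
      simpa using this.symm
    rw [← integral_add_adjacent_intervals (i1.congr e1) ((i2.mul_const (-δ)).congr e2),
      ← integral_congr_ae (ae_of_all _ e1), ← integral_congr_ae (ae_of_all _ e2),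
      intervalIntegral.integral_mul_const, integral_comp_sub_left (fun x => σ x), integral_comp_sub_left (fun x => σ x),
      ← integral_add_adjacent_intervals (hint 0 (u - 1) le_rfl (by linarith))
        (hint (u - 1) u (by linarith) (by linarith))]
    simp
    ring

/-- A `δ`-solution with smallest positive zero `U`, extended by `1` to the negative half-line. -/
structure IsDelayProfile (δ U : ℝ) (f : ℝ → ℝ) : Prop where
  continuous : Continuous f
  eq_one : ∀ x ≤ 1, f x = 1
  mul_eq : ∀ u, 1 ≤ u → u * f u = (∫ t in (0:ℝ)..u, f t) - (1 + δ) * ∫ t in (0:ℝ)..(u - 1), f t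
  one_lt : 1 < U
  eq_zero : f U = 0
  pos : ∀ u < U, 0 < f u

lemma IsDeltaSolution.isDelayProfile {δ U : ℝ} {σ : ℝ → ℝ} (h : IsDeltaSolution δ σ)
    (hU : IsSmallestPosZero σ U) : IsDelayProfile δ U (fun x => σ (max x 0)) := by
  have hc : Continuous (fun x => σ (max x 0)) :=
    h.1.comp_continuous (by fun_prop) fun x => Set.mem_Ici.2 (le_max_right _ _)
  have hone : ∀ x ≤ 1, σ (max x 0) = 1 := fun x hx =>
    h.2.1 _ (le_max_right _ _) (max_le hx zero_le_one)
  have hint : ∀ u : ℝ, 0 ≤ u → ∫ t in (0:ℝ)..u, σ (max t 0) = ∫ t in (0:ℝ)..u, σ t := by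
    intro u hu
    refine integral_congr fun t ht => ?_
    rw [Set.uIcc_of_le hu] at ht
    simp [ht.1]
  have hU1 : 1 < U := by
    by_contra! hle
    have := h.2.1 U hU.1.le hle
    rw [hU.2.1] at this
    norm_num at this
  refine ⟨hc, hone, ?_, hU1, ?_, ?_⟩
  · intro u hu
    rw [hint u (by linarith), hint (u - 1) (by linarith), max_eq_left (by linarith), h.mul_eq hu]
  · simpa [hU.1.le] using hU.2.1
  · intro u hu
    by_contra! hle
    have h0 : 1 ≤ u := by
      by_contra! hlt
      rw [hone u hlt.le] at hle
      norm_num at hle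
    obtain ⟨v, hv, hv0⟩ := intermediate_value_Icc' h0 hc.continuousOn
      (show (0:ℝ) ∈ Set.Icc _ _ from ⟨hle, by simp [h.2.1]⟩)
    have hv1 : 1 ≤ v := hv.1
    replace hv0 : σ (max v 0) = 0 := hv0
    rw [max_eq_left (by linarith)] at hv0
    linarith [hU.2.2 v (by linarith) hv0, hv.2]

namespace IsDelayProfile

variable {δ U : ℝ} {f : ℝ → ℝ}

lemma nonneg (h : IsDelayProfile δ U f) {u : ℝ} (hu : u ≤ U) : 0 ≤ f u := by
  rcases hu.eq_or_lt with rfl | hu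
  · exact h.eq_zero.ge
  · exact (h.pos u hu).le

lemma hasDerivAt (h : IsDelayProfile δ U f) {u : ℝ} (hu : 1 < u) :
    HasDerivAt f (-((1 + δ) * f (u - 1) / u)) u := by
  have hS : ∀ x, HasDerivAt (fun x => ∫ t in (0:ℝ)..x, f t) (f x) x := fun x =>
    integral_hasDerivAt_right (h.continuous.intervalIntegrable _ _)
      (h.continuous.stronglyMeasurableAtFilter _ _) h.continuous.continuousAt
  have hS' := (hS (u - 1)).comp_sub_const u 1
  have hu0 : u ≠ 0 := by linarith
  have hd := ((hS u).sub (hS'.const_mul (1 + δ))).div (hasDerivAt_id u) hu0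
  have heq := h.mul_eq u hu.le
  refine (hd.congr_of_eventuallyEq ?_).congr_deriv ?_
  · filter_upwards [lt_mem_nhds hu] with v hv
    have := h.mul_eq v hv.le
    have hv0 : v ≠ 0 := by linarith
    simp only [Pi.div_apply, Pi.sub_apply, id]
    rw [← this]
    field_simp
  · simp only [Pi.sub_apply, id]
    rw [← heq]
    field_simp
    ring

lemma hasDerivAt_of_lt_one (h : IsDelayProfile δ U f) {u : ℝ} (hu : u < 1) :
    HasDerivAt f 0 u := by
  refine (hasDerivAt_const u (1:ℝ)).congr_of_eventuallyEq ?_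
  filter_upwards [gt_mem_nhds hu] with v hv
  exact h.eq_one v hv.le

lemma antitoneOn (h : IsDelayProfile δ U f) (hδ : 0 ≤ δ) : AntitoneOn f (Set.Iic U) := by
  have h1 : AntitoneOn f (Set.Icc 1 U) := by
    refine antitoneOn_of_deriv_nonpos (convex_Icc _ _) h.continuous.continuousOn ?_ ?_
    · rw [interior_Icc]
      exact fun x hx => (h.hasDerivAt hx.1).differentiableAt.differentiableWithinAt
    · rw [interior_Icc]
      intro x hx
      rw [(h.hasDerivAt hx.1).deriv, neg_nonpos]
      have := h.nonneg (u := x - 1) (by linarith [hx.2])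
      have : 0 ≤ x := by linarith [hx.1]
      positivity
  intro x hx y hy hxy
  rcases le_total y 1 with hy1 | hy1
  · rw [h.eq_one y hy1, h.eq_one x (hxy.trans hy1)]
  · rcases le_total x 1 with hx1 | hx1
    · rw [h.eq_one x hx1, ← h.eq_one 1 le_rfl]
      exact h1 ⟨le_rfl, h.one_lt.le⟩ ⟨hy1, hy⟩ hy1
    · exact h1 ⟨hx1, hx⟩ ⟨hy1, hy⟩ hxy

lemma le_one (h : IsDelayProfile δ U f) (hδ : 0 ≤ δ) {u : ℝ} (hu : u ≤ U) : f u ≤ 1 := by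
  rcases le_total u 1 with hu1 | hu1
  · exact (h.eq_one u hu1).le
  · rw [← h.eq_one 1 le_rfl]
    exact h.antitoneOn hδ h.one_lt.le hu hu1

lemma integral_eq (h : IsDelayProfile δ U f) :
    ∫ t in (0:ℝ)..U, f t = (1 + δ) * ∫ t in (0:ℝ)..(U - 1), f t := by
  have := h.mul_eq U h.one_lt.le
  rw [h.eq_zero] at this
  linarith

lemma mul_le (h : IsDelayProfile δ U f) (hδ : 0 ≤ δ) {u : ℝ} (hu : 1 ≤ u) (huU : u ≤ U) :
    u * f u ≤ f (u - 1) := by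
  have h0 : 0 ≤ ∫ t in (0:ℝ)..(u - 1), f t :=
    integral_nonneg (by linarith) fun t ht => h.nonneg (by linarith [ht.2])
  have h1 : ∫ t in (u - 1)..u, f t ≤ ∫ t in (u - 1)..u, f (u - 1) := by
    refine integral_mono_on (by linarith) (h.continuous.intervalIntegrable _ _)
      intervalIntegrable_const fun t ht => ?_
    exact h.antitoneOn hδ (by simp; linarith) (ht.2.trans huU) ht.1
  have h2 := integral_add_adjacent_intervals (h.continuous.intervalIntegrable 0 (u - 1))
    (μ := volume) (h.continuous.intervalIntegrable (u - 1) u)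
  have h3 := h.mul_eq u hu
  simp only [intervalIntegral.integral_const, sub_sub_cancel, one_smul] at h1
  nlinarith

lemma integral_le (h : IsDelayProfile δ U f) (hδ : 0 ≤ δ) : ∫ t in (0:ℝ)..U, f t ≤ 4 := by
  have hi : ∀ a b, IntervalIntegrable f volume a b := fun a b =>
    h.continuous.intervalIntegrable a b
  have hle : ∀ a b : ℝ, 0 ≤ a → a ≤ b → b ≤ U → ∫ t in a..b, f t ≤ b - a := by
    intro a b ha hab hb
    calc ∫ t in a..b, f t ≤ ∫ t in a..b, (1:ℝ) := integral_mono_on hab (hi _ _)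
          intervalIntegrable_const fun t ht => h.le_one hδ (ht.2.trans hb)
      _ = b - a := by simp
  rcases le_total U 2 with h2 | h2
  · linarith [hle 0 U le_rfl (by linarith [h.one_lt]) le_rfl]
  · have e1 : ∫ t in (2:ℝ)..U, f t ≤ ∫ t in (2:ℝ)..U, (1 / 2) * f (t - 1) := by
      refine integral_mono_on h2 (hi _ _) ?_ fun t ht => ?_
      · exact Continuous.intervalIntegrable (by have := h.continuous; fun_prop) _ _
      · have h1 := h.mul_le hδ (u := t) (by linarith [ht.1]) ht.2
        have h3 := h.nonneg ht.2
        nlinarith [ht.1]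
    rw [intervalIntegral.integral_const_mul, integral_comp_sub_right] at e1
    have e2 : ∫ t in (2 - 1:ℝ)..(U - 1), f t ≤ ∫ t in (0:ℝ)..U, f t := by
      refine integral_mono_interval (by norm_num) (by linarith) (by linarith) ?_ (hi _ _)
      refine (ae_restrict_iff' measurableSet_Ioc).2 (ae_of_all _ fun t ht => h.nonneg ht.2)
    have e3 := integral_add_adjacent_intervals (hi 0 2) (hi 2 U)
    have e4 := hle 0 2 le_rfl (by norm_num) h2
    replace e1 := e1.trans (mul_le_mul_of_nonneg_left e2 (by norm_num))
    linarith

end IsDelayProfile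

/-- A bounded multiplier with values in `[-δ, 1]`, continuous away from `1` and `U`. -/
structure IsMultiplier (δ U : ℝ) (χ : ℝ → ℝ) : Prop where
  measurable : Measurable χ
  mem : ∀ t, χ t ∈ Set.Icc (-δ) 1
  continuousAt : ∀ t, t ≠ 1 → t ≠ U → ContinuousAt χ t

namespace IsMultiplier

variable {δ U : ℝ} {χ K : ℝ → ℝ}

lemma abs_le (h : IsMultiplier δ U χ) (hδ : δ ≤ 1) (t : ℝ) : |χ t| ≤ 1 :=
  _root_.abs_le.2 ⟨by linarith [(h.mem t).1], (h.mem t).2⟩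

lemma intervalIntegrable (h : IsMultiplier δ U χ) (hδ : δ ≤ 1) (a b : ℝ) :
    IntervalIntegrable χ volume a b :=
  (intervalIntegrable_const (c := (1:ℝ))).mono_fun h.measurable.aestronglyMeasurable
    (ae_of_all _ fun t => by simpa using h.abs_le hδ t)

lemma intervalIntegrable_mul (h : IsMultiplier δ U χ) (hδ : δ ≤ 1) {a b : ℝ}
    (hK : IntervalIntegrable K volume a b) (t : ℝ) :
    IntervalIntegrable (fun s => K s * χ (t - s)) volume a b := by
  have hm : Measurable fun s => χ (t - s) := h.measurable.comp (by fun_prop)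
  refine hK.mono_fun (hK.aestronglyMeasurable_restrict_uIoc.mul hm.aestronglyMeasurable)
    (ae_of_all _ fun s => ?_)
  simp only [norm_mul, Real.norm_eq_abs]
  exact mul_le_of_le_one_right (abs_nonneg _) (h.abs_le hδ _)

lemma continuous_integral (h : IsMultiplier δ U χ) (hδ : δ ≤ 1) {a b : ℝ}
    (hK : IntervalIntegrable K volume a b) :
    Continuous fun t => ∫ s in a..b, K s * χ (t - s) := by
  rw [continuous_iff_continuousAt]
  intro t
  refine continuousAt_of_dominated_interval (bound := fun s => |K s|) ?_ ?_ hK.abs ?_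
  · exact Eventually.of_forall fun t =>
      (h.intervalIntegrable_mul hδ hK t).aestronglyMeasurable_restrict_uIoc
  · refine Eventually.of_forall fun t => ae_of_all _ fun s _ => ?_
    simp only [norm_mul, Real.norm_eq_abs]
    exact mul_le_of_le_one_right (abs_nonneg _) (h.abs_le hδ _)
  · have h1 : ∀ᵐ s : ℝ, s ≠ t - 1 := by simp [ae_iff]
    have h2 : ∀ᵐ s : ℝ, s ≠ t - U := by simp [ae_iff]
    filter_upwards [h1, h2] with s hs1 hs2 _
    refine continuousAt_const.mul ?_
    refine ContinuousAt.comp (f := fun x : ℝ => x - s) (g := χ) (h.continuousAt _ ?_ ?_)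
      (by fun_prop)
    · exact fun e => hs1 (by linarith)
    · exact fun e => hs2 (by linarith)

end IsMultiplier

/-- One step of the recursion `χ(t) = ∫ K(s) χ(t - s) ds` for `t > U`. -/
noncomputable def averageStep (δ U : ℝ) (K χ : ℝ → ℝ) (t : ℝ) : ℝ :=
  if t ≤ U then chiDelta δ t else ∫ s in (1:ℝ)..U, K s * χ (t - s)

lemma isMultiplier_chiDelta {δ : ℝ} (U : ℝ) (hδ0 : 0 ≤ δ) : IsMultiplier δ U (chiDelta δ) := by
  refine ⟨Measurable.ite measurableSet_Iic measurable_const measurable_const, fun t => ?_,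
    fun t h1 _ => ?_⟩
  · unfold chiDelta
    split_ifs <;> constructor <;> linarith
  · rcases h1.lt_or_gt with h | h
    · refine (continuousAt_const (y := (1:ℝ))).congr ?_
      filter_upwards [gt_mem_nhds h] with v hv
      simp [chiDelta, hv.le]
    · refine (continuousAt_const (y := -δ)).congr ?_
      filter_upwards [lt_mem_nhds h] with v hv
      simp [chiDelta, hv]

lemma IsMultiplier.averageStep {δ U : ℝ} {χ K : ℝ → ℝ} (h : IsMultiplier δ U χ) (hδ0 : 0 ≤ δ)
    (hδ : δ ≤ 1) (hU : 1 < U) (hK : IntervalIntegrable K volume 1 U)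
    (hK0 : ∀ s ∈ Set.Icc 1 U, 0 ≤ K s) (hK1 : ∫ s in (1:ℝ)..U, K s = 1) :
    IsMultiplier δ U (averageStep δ U K χ) := by
  have hd := isMultiplier_chiDelta U hδ0
  have hc := h.continuous_integral hδ hK
  refine ⟨Measurable.ite measurableSet_Iic hd.measurable hc.measurable, fun t => ?_,
    fun t h1 hU => ?_⟩
  · unfold _root_.averageStep
    split_ifs
    · exact hd.mem t
    · have hi := h.intervalIntegrable_mul hδ hK t
      constructor
      · calc -δ = ∫ s in (1:ℝ)..U, K s * (-δ) := by
              rw [intervalIntegral.integral_mul_const, hK1, one_mul]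
          _ ≤ _ := integral_mono_on hU.le (hK.mul_const _) hi fun s hs =>
              mul_le_mul_of_nonneg_left (h.mem _).1 (hK0 s hs)
      · calc _ ≤ ∫ s in (1:ℝ)..U, K s := integral_mono_on hU.le hi hK fun s hs =>
              mul_le_of_le_one_right (hK0 s hs) (h.mem _).2
          _ = 1 := hK1
  · rcases hU.lt_or_gt with h' | h'
    · refine (hd.continuousAt t h1 hU).congr ?_
      filter_upwards [gt_mem_nhds h'] with v hv
      simp [_root_.averageStep, hv.le]
    · refine hc.continuousAt.congr ?_
      filter_upwards [lt_mem_nhds h'] with v hv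
      simp [_root_.averageStep, hv]

/-- The delay equation `χ(t) = ∫ K(s) χ(t - s) ds`, `t > U`, can be solved with initial
values `χ_δ` on `(-∞, U]`. -/
lemma exists_averageStep_fixed {δ U : ℝ} {K : ℝ → ℝ} (hδ0 : 0 ≤ δ)
    (hδ : δ ≤ 1) (hU : 1 < U) (hK : IntervalIntegrable K volume 1 U)
    (hK0 : ∀ s ∈ Set.Icc 1 U, 0 ≤ K s) (hK1 : ∫ s in (1:ℝ)..U, K s = 1) :
    ∃ χ, IsMultiplier δ U χ ∧ ∀ t, χ t = averageStep δ U K χ t := by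
  set X : ℕ → ℝ → ℝ := fun n => (averageStep δ U K)^[n] (chiDelta δ) with hX
  have hsucc : ∀ n, X (n + 1) = averageStep δ U K (X n) := fun n =>
    Function.iterate_succ_apply' _ _ _
  have hgood : ∀ n, IsMultiplier δ U (X n) := by
    intro n
    induction n with
    | zero => exact isMultiplier_chiDelta U hδ0
    | succ n ih =>
      rw [hsucc]
      exact ih.averageStep hδ0 hδ hU hK hK0 hK1
  have hcongr : ∀ (χ₁ χ₂ : ℝ → ℝ) (c : ℝ), (∀ t ≤ c, χ₁ t = χ₂ t) →
      ∀ t ≤ c + 1, averageStep δ U K χ₁ t = averageStep δ U K χ₂ t := by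
    intro χ₁ χ₂ c hc t ht
    unfold averageStep
    split_ifs
    · rfl
    · refine integral_congr fun s hs => ?_
      rw [Set.uIcc_of_le hU.le] at hs
      rw [hc _ (by linarith [hs.1])]
  have hstep : ∀ n : ℕ, ∀ t ≤ U + n, X (n + 1) t = X n t := by
    intro n
    induction n with
    | zero =>
      intro t ht
      rw [hsucc]
      have ht' : t ≤ U := by simpa using ht
      simp [averageStep, ht', hX]
    | succ n ih =>
      intro t ht
      rw [hsucc (n + 1), hsucc n]
      refine hcongr _ _ (U + n) ?_ t (by push_cast at ht; linarith)
      intro s hs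
      rw [← hsucc n, ih s hs]
  have hstable : ∀ n m : ℕ, n ≤ m → ∀ t ≤ U + n, X m t = X n t := by
    intro n m hnm
    induction m, hnm using Nat.le_induction with
    | base => exact fun _ _ => rfl
    | succ m hm ih =>
      intro t ht
      have : (n : ℝ) ≤ m := by exact_mod_cast hm
      rw [hstep m t (by linarith), ih t ht]
  set χ : ℝ → ℝ := fun t => X ⌈t⌉₊ t with hχ
  have hχX : ∀ n : ℕ, ∀ t ≤ U + n, χ t = X n t := by
    intro n t ht
    rcases le_total n ⌈t⌉₊ with h | h
    · exact hstable _ _ h t ht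
    · exact (hstable _ _ h t (by linarith [Nat.le_ceil t])).symm
  have hev : ∀ t, ∀ᶠ n : ℕ in atTop, X n t = χ t := fun t => by
    filter_upwards [eventually_ge_atTop ⌈t⌉₊] with n hn
    exact hstable _ _ hn t (by linarith [Nat.le_ceil t])
  refine ⟨χ, ⟨?_, fun t => (hgood _).mem t, fun t h1 h2 => ?_⟩, fun t => ?_⟩
  · refine measurable_of_tendsto_metrizable (fun n => (hgood n).measurable)
      (tendsto_pi_nhds.2 fun t => ?_)
    exact tendsto_const_nhds.congr' ((hev t).mono fun n hn => hn.symm)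
  · refine ((hgood ⌈t⌉₊).continuousAt t h1 h2).congr ?_
    have : t < U + ⌈t⌉₊ := by linarith [Nat.le_ceil t]
    filter_upwards [gt_mem_nhds this] with v hv
    exact (hχX _ v hv.le).symm
  · have ht : t ≤ U + ⌈t⌉₊ := by linarith [Nat.le_ceil t]
    rw [hχX (⌈t⌉₊ + 1) t (by push_cast; linarith), hsucc]
    exact hcongr _ _ (U + ⌈t⌉₊) (fun s hs => (hχX _ s hs).symm) t (by linarith)

/-- The kernel `-f'` on `[1, U]`. -/
noncomputable def delayKernel (δ : ℝ) (f : ℝ → ℝ) (s : ℝ) : ℝ := (1 + δ) * f (s - 1) / s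

namespace IsDelayProfile

variable {δ U : ℝ} {f : ℝ → ℝ}

lemma intervalIntegrable_delayKernel (h : IsDelayProfile δ U f) :
    IntervalIntegrable (delayKernel δ f) volume 1 U := by
  refine ContinuousOn.intervalIntegrable ?_
  rw [Set.uIcc_of_le h.one_lt.le]
  have := h.continuous
  exact ContinuousOn.div (by fun_prop) continuousOn_id fun x hx => by
    exact (zero_lt_one.trans_le hx.1).ne'

lemma delayKernel_nonneg (h : IsDelayProfile δ U f) (hδ : 0 ≤ δ) :
    ∀ s ∈ Set.Icc 1 U, 0 ≤ delayKernel δ f s := by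
  intro s hs
  have := h.nonneg (u := s - 1) (by linarith [hs.2])
  have : 0 ≤ s := by linarith [hs.1]
  unfold delayKernel
  positivity

lemma integral_delayKernel (h : IsDelayProfile δ U f) :
    ∫ s in (1:ℝ)..U, delayKernel δ f s = 1 := by
  have := integral_eq_sub_of_hasDerivAt_of_le h.one_lt.le h.continuous.continuousOn
    (fun x hx => h.hasDerivAt hx.1) h.intervalIntegrable_delayKernel.neg
  have e : ∫ s in (1:ℝ)..U, -delayKernel δ f s = f U - f 1 := this
  rw [intervalIntegral.integral_neg, h.eq_zero, h.eq_one 1 le_rfl] at e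
  linarith

/-- Integration by parts for the convolution of `f` with a multiplier. -/
lemma integral_mul_multiplier (h : IsDelayProfile δ U f) {χ : ℝ → ℝ} (hχ : IsMultiplier δ U χ)
    (hδ : δ ≤ 1) (u : ℝ) :
    ∫ s in (0:ℝ)..U, f s * χ (u - s) =
      ∫ s in (1:ℝ)..U, delayKernel δ f s * ∫ t in (u - s)..u, χ t := by
  have hi := hχ.intervalIntegrable hδ
  have hXc : Continuous fun s => ∫ t in (u - s)..u, χ t := by
    have := (continuous_primitive hi u).neg.comp (show Continuous fun s => u - s by fun_prop)
    refine this.congr fun s => ?_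
    simp [integral_symm u (u - s)]
  have hXd : ∀ s, u - s ≠ 1 → u - s ≠ U →
      HasDerivAt (fun s => ∫ t in (u - s)..u, χ t) (χ (u - s)) s := by
    intro s h1 h2
    have hd : HasDerivAt (fun x => ∫ t in x..u, χ t) (-χ (u - s)) (u - s) :=
      integral_hasDerivAt_left (hi _ _) (hχ.measurable.stronglyMeasurable.stronglyMeasurableAtFilter)
        (hχ.continuousAt _ h1 h2)
    simpa using hd.comp_const_sub u s
  have hfχ := hχ.intervalIntegrable_mul hδ (h.continuous.intervalIntegrable (μ := volume) 0 U) u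
  have hfχ0 := hχ.intervalIntegrable_mul hδ (h.continuous.intervalIntegrable (μ := volume) 0 1) u
  have hfχ1 := hχ.intervalIntegrable_mul hδ (h.continuous.intervalIntegrable (μ := volume) 1 U) u
  have hKX := (h.intervalIntegrable_delayKernel).mul_continuousOn (hXc.continuousOn)
  have hcount : ({u - 1, u - U} : Set ℝ).Countable := (Set.toFinite _).countable
  have hne : ∀ {x : ℝ}, x ∉ ({u - 1, u - U} : Set ℝ) → u - x ≠ 1 ∧ u - x ≠ U := by
    intro x hx
    simp only [Set.mem_insert_iff, Set.mem_singleton_iff, not_or] at hx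
    exact ⟨fun e => hx.1 (by linarith), fun e => hx.2 (by linarith)⟩
  have A := integral_eq_of_hasDerivAt_off_countable_of_le
    (fun s => f s * ∫ t in (u - s)..u, χ t) (fun s => f s * χ (u - s)) zero_le_one hcount
    (h.continuous.mul hXc).continuousOn (fun x hx => by
      have := (h.hasDerivAt_of_lt_one hx.1.2).mul (hXd x (hne hx.2).1 (hne hx.2).2)
      exact this.congr_deriv (by simp)) hfχ0
  have B := integral_eq_of_hasDerivAt_off_countable_of_le
    (fun s => f s * ∫ t in (u - s)..u, χ t)
    (fun s => f s * χ (u - s) - delayKernel δ f s * ∫ t in (u - s)..u, χ t) h.one_lt.le hcount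
    (h.continuous.mul hXc).continuousOn (fun x hx => by
      have := (h.hasDerivAt hx.1.1).mul (hXd x (hne hx.2).1 (hne hx.2).2)
      refine this.congr_deriv ?_
      unfold delayKernel
      ring) (hfχ1.sub hKX)
  rw [intervalIntegral.integral_sub hfχ1 hKX] at B
  rw [← integral_add_adjacent_intervals hfχ0 hfχ1, A]
  simp only [h.eq_zero, sub_zero, integral_same, mul_zero, zero_mul] at B ⊢
  linarith

/-- For a solution of the delay equation, the convolution with `f` is constant beyond `U`. -/
lemma integral_mul_multiplier_eq (h : IsDelayProfile δ U f) {χ : ℝ → ℝ}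
    (hχ : IsMultiplier δ U χ) (hδ : δ ≤ 1)
    (hfix : ∀ t, χ t = averageStep δ U (delayKernel δ f) χ t) {u : ℝ} (hu : U ≤ u) :
    ∫ s in (0:ℝ)..U, f s * χ (u - s) = ∫ s in (0:ℝ)..U, f s * χ (U - s) := by
  have hi := hχ.intervalIntegrable hδ
  have hK := h.intervalIntegrable_delayKernel
  have hXc : ∀ u, Continuous fun s => ∫ t in (u - s)..u, χ t := by
    intro u
    have := (continuous_primitive hi u).neg.comp (show Continuous fun s => u - s by fun_prop)
    refine this.congr fun s => ?_
    simp [integral_symm u (u - s)]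
  have key : ∫ v in U..u, χ v = ∫ s in (1:ℝ)..U, delayKernel δ f s * ∫ v in (U - s)..(u - s), χ v := by
    have e1 : ∫ v in U..u, χ v = ∫ v in U..u, ∫ s in (1:ℝ)..U, delayKernel δ f s * χ (v - s) := by
      refine integral_congr_ae (ae_of_all _ fun v hv => ?_)
      rw [Set.uIoc_of_le hu] at hv
      rw [hfix v, averageStep, if_neg (not_le.2 hv.1)]
    rw [e1, intervalIntegral_intervalIntegral_swap]
    · refine integral_congr fun s _ => ?_
      simp only [intervalIntegral.integral_const_mul]
      rw [integral_comp_sub_right (fun x => χ x)]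
    · rw [IntegrableOn, Measure.volume_eq_prod, ← Measure.prod_restrict]
      have h1 : Integrable (fun z : ℝ × ℝ => 1 * delayKernel δ f z.2)
          ((volume.restrict (Set.uIoc U u)).prod (volume.restrict (Set.uIoc 1 U))) :=
        (intervalIntegrable_iff.1 (intervalIntegrable_const (c := (1:ℝ)))).mul_prod
          (intervalIntegrable_iff.1 hK)
      simp only [one_mul] at h1
      refine h1.mul_bdd (c := 1) (g := fun z : ℝ × ℝ => χ (z.1 - z.2)) ?_
        (ae_of_all _ fun z => hχ.abs_le hδ _)
      exact (hχ.measurable.comp (by fun_prop)).aestronglyMeasurable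
  rw [h.integral_mul_multiplier hχ hδ, h.integral_mul_multiplier hχ hδ, ← sub_eq_zero,
    ← intervalIntegral.integral_sub (hK.mul_continuousOn (hXc u).continuousOn)
      (hK.mul_continuousOn (hXc U).continuousOn)]
  have e2 : ∀ s, delayKernel δ f s * (∫ t in (u - s)..u, χ t) -
      delayKernel δ f s * (∫ t in (U - s)..U, χ t) = delayKernel δ f s * (∫ v in U..u, χ v) -
        delayKernel δ f s * ∫ v in (U - s)..(u - s), χ v := by
    intro s
    have a := integral_add_adjacent_intervals (hi (U - s) (u - s)) (hi (u - s) u)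
    have b := integral_add_adjacent_intervals (hi (U - s) U) (hi U u)
    rw [← mul_sub, ← mul_sub]
    congr 1
    linarith
  have hXc2 : Continuous fun s => ∫ v in (U - s)..(u - s), χ v := by
    have a := continuous_primitive hi 0
    have := (a.comp (show Continuous fun s => u - s by fun_prop)).sub
      (a.comp (show Continuous fun s => U - s by fun_prop))
    refine this.congr fun s => ?_
    have := integral_add_adjacent_intervals (hi 0 (U - s)) (hi (U - s) (u - s))
    change (∫ t in (0:ℝ)..(u - s), χ t) - (∫ t in (0:ℝ)..(U - s), χ t) = _
    linarith
  simp only [e2]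
  rw [intervalIntegral.integral_sub (hK.mul_const _) (hK.mul_continuousOn hXc2.continuousOn), ← key,
    intervalIntegral.integral_mul_const, h.integral_delayKernel, one_mul, sub_self]

end IsDelayProfile

lemma exists_multiplier_vanishing_solution {δ : ℝ} (hδ0 : 0 < δ) (hδ : δ ≤ 1) {σδ : ℝ → ℝ}
    (hσ : IsDeltaSolution δ σδ) {U : ℝ} (hU : IsSmallestPosZero σδ U) :
    ∃ χ σ : ℝ → ℝ, Measurable χ ∧
      (∀ t : ℝ, 0 ≤ t → χ t ∈ Set.Icc (-δ) 1) ∧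
      (∀ t : ℝ, 0 ≤ t → t ≤ 1 → χ t = 1) ∧
      (∀ t : ℝ, 1 < t → t ≤ U → χ t = -δ) ∧
      ContinuousOn χ (Set.Ioi U) ∧
      ContinuousOn σ (Set.Ici 0) ∧
      (∀ u : ℝ, 0 ≤ u → u ≤ 1 → σ u = 1) ∧
      (∀ u : ℝ, 1 < u → u * σ u = ∫ t in (0:ℝ)..u, σ (u - t) * χ t) ∧
      (∀ u : ℝ, 0 ≤ u → u ≤ U → σ u = σδ u) ∧
      (∀ u : ℝ, U ≤ u → σ u = 0) := by
  set f : ℝ → ℝ := fun x => σδ (max x 0) with hf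
  have h : IsDelayProfile δ U f := hσ.isDelayProfile hU
  have hU1 := h.one_lt
  obtain ⟨χ, hχ, hfix⟩ := exists_averageStep_fixed hδ0.le hδ hU1 h.intervalIntegrable_delayKernel
    (h.delayKernel_nonneg hδ0.le) h.integral_delayKernel
  have hχδ : ∀ t ≤ U, χ t = chiDelta δ t := fun t ht => by
    rw [hfix, averageStep, if_pos ht]
  have hfσ : ∀ u, 0 ≤ u → f u = σδ u := fun u hu => by simp only [hf, max_eq_left hu]
  have hvan : ∀ u, U ≤ u → f (min u U) = 0 := fun u hu => by rw [min_eq_right hu, h.eq_zero]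
  have hfc := h.continuous
  have hgc : Continuous fun u => f (min u U) := by fun_prop
  have hbelow : ∀ u, 1 < u → u ≤ U → u * f u = ∫ t in (0:ℝ)..u, f (u - t) * χ t := by
    intro u hu huU
    rw [hfσ u (by linarith), hσ.2.2 u hu]
    refine integral_congr fun t ht => ?_
    rw [Set.uIcc_of_le (by linarith)] at ht
    rw [hfσ _ (by linarith [ht.2]), hχδ t (ht.2.trans huU)]
  have hrev : ∀ (g : ℝ → ℝ) (u : ℝ),
      ∫ t in (0:ℝ)..u, g (u - t) * χ t = ∫ s in (0:ℝ)..u, g s * χ (u - s) := by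
    intro g u
    have := integral_comp_sub_left (a := 0) (b := u) (fun s => g s * χ (u - s)) u
    simpa using this
  refine ⟨χ, fun u => f (min u U), hχ.measurable, fun t _ => hχ.mem t, fun t _ ht => ?_,
    fun t h1 ht => ?_, fun t ht => ?_, hgc.continuousOn, fun u _ hu => ?_, fun u hu => ?_,
    fun u hu huU => ?_, hvan⟩
  · rw [hχδ t (by linarith), chiDelta, if_pos ht]
  · rw [hχδ t ht, chiDelta, if_neg (not_le.2 h1)]
  · have ht' : U < t := ht
    exact (hχ.continuousAt t (by linarith) ht'.ne').continuousWithinAt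
  · exact h.eq_one _ ((min_le_left _ _).trans hu)
  · rcases le_total u U with huU | huU
    · simp only [min_eq_left huU]
      rw [hbelow u hu huU]
      refine integral_congr fun t ht => ?_
      rw [Set.uIcc_of_le (by linarith)] at ht
      rw [min_eq_left (by linarith [ht.1])]
    · have hi : ∀ a b, IntervalIntegrable (fun s => f (min s U) * χ (u - s)) volume a b :=
        fun a b => hχ.intervalIntegrable_mul hδ (hgc.intervalIntegrable a b) u
      have e1 : ∫ s in (0:ℝ)..U, f (min s U) * χ (u - s) = ∫ s in (0:ℝ)..U, f s * χ (u - s) := by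
        refine integral_congr fun t ht => ?_
        rw [Set.uIcc_of_le (by linarith)] at ht
        rw [min_eq_left ht.2]
      have e2 : ∫ s in U..u, f (min s U) * χ (u - s) = 0 := by
        refine integral_zero_ae (ae_of_all _ fun t ht => ?_)
        rw [Set.uIoc_of_le huU] at ht
        rw [hvan t ht.1.le, zero_mul]
      beta_reduce
      rw [hvan u huU, mul_zero, hrev (fun u => f (min u U)),
        ← integral_add_adjacent_intervals (hi 0 U) (hi U u), e1, e2,
        h.integral_mul_multiplier_eq hχ hδ hfix huU, ← hrev, ← hbelow U hU1 le_rfl, h.eq_zero]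
      simp
  · beta_reduce
    rw [min_eq_left huU, hfσ u hu]

/-- The complementary exponential integral `Ein(s) = ∫_0^s (1 - e^{-t}) / t dt`, `s ≥ 0`, in a form
obtained by integration by parts. -/
noncomputable def expIntegralEin (s : ℝ) : ℝ :=
  (1 - Real.exp (-s)) * Real.log s - ∫ t in (0:ℝ)..s, Real.exp (-t) * Real.log t

lemma intervalIntegrable_exp_neg_mul_log (a b : ℝ) :
    IntervalIntegrable (fun t => Real.exp (-t) * Real.log t) volume a b :=
  intervalIntegrable_log'.continuousOn_mul (by fun_prop)

lemma expIntegralEin_zero : expIntegralEin 0 = 0 := by simp [expIntegralEin]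

lemma continuous_expIntegralEin : Continuous expIntegralEin := by
  refine Continuous.sub ?_ (continuous_primitive intervalIntegrable_exp_neg_mul_log 0)
  have hd : Continuous (dslope (fun s : ℝ => 1 - Real.exp (-s)) 0) := by
    rw [← continuousOn_univ, continuousOn_dslope univ_mem]
    exact ⟨by fun_prop, by fun_prop⟩
  refine (hd.mul Real.continuous_mul_log).congr fun s => ?_
  have := sub_smul_dslope (fun s : ℝ => 1 - Real.exp (-s)) 0 s
  simp only [sub_zero, smul_eq_mul, neg_zero, Real.exp_zero, sub_self] at this
  change dslope _ 0 s * (s * Real.log s) = _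
  rw [← this]
  ring

lemma hasDerivAt_expIntegralEin {s : ℝ} (hs : 0 < s) :
    HasDerivAt expIntegralEin ((1 - Real.exp (-s)) / s) s := by
  have h1 : HasDerivAt (fun s : ℝ => 1 - Real.exp (-s)) (Real.exp (-s)) s := by
    simpa using ((hasDerivAt_neg s).exp).const_sub 1
  have hc : ContinuousAt (fun t => Real.exp (-t) * Real.log t) s :=
    (by fun_prop : Continuous fun t : ℝ => Real.exp (-t)).continuousAt.mul
      (Real.continuousAt_log hs.ne')
  have h2 := integral_hasDerivAt_right (intervalIntegrable_exp_neg_mul_log 0 s)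
    (Measurable.stronglyMeasurable (by fun_prop)).stronglyMeasurableAtFilter hc
  refine ((h1.mul (Real.hasDerivAt_log hs.ne')).sub h2).congr_deriv ?_
  ring

lemma expIntegralEin_le_of_le {a b : ℝ} (ha : 0 ≤ a) (hab : a ≤ b) {g g' : ℝ → ℝ}
    (hg : ContinuousOn g (Set.Icc a b)) (hg' : ∀ s ∈ Set.Ioo a b, HasDerivAt g (g' s) s)
    (hle : ∀ s ∈ Set.Ioo a b, (1 - Real.exp (-s)) / s ≤ g' s) :
    expIntegralEin b - g b ≤ expIntegralEin a - g a := by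
  have hd : ∀ s ∈ Set.Ioo a b, HasDerivAt (fun s => expIntegralEin s - g s)
      ((1 - Real.exp (-s)) / s - g' s) s := fun s hs =>
    (hasDerivAt_expIntegralEin (ha.trans_lt hs.1)).sub (hg' s hs)
  have : AntitoneOn (fun s => expIntegralEin s - g s) (Set.Icc a b) := by
    refine antitoneOn_of_deriv_nonpos (convex_Icc _ _)
      (continuous_expIntegralEin.continuousOn.sub hg) ?_ ?_ <;> rw [interior_Icc]
    · exact fun s hs => (hd s hs).differentiableAt.differentiableWithinAt
    · intro s hs
      rw [(hd s hs).deriv]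
      linarith [hle s hs]
  exact this ⟨le_rfl, hab⟩ ⟨hab, le_rfl⟩ hab

lemma exp_expIntegralEin_le_of_le_one {s : ℝ} (hs : 0 ≤ s) (hs1 : s ≤ 1) :
    Real.exp (expIntegralEin s) ≤ Real.exp 1 := by
  have := expIntegralEin_le_of_le le_rfl hs (g := id) (g' := fun _ => 1) continuousOn_id
    (fun x _ => hasDerivAt_id x) (fun x hx => by
      rw [div_le_one hx.1]
      linarith [Real.add_one_le_exp (-x)])
  simp only [expIntegralEin_zero, id] at this
  exact Real.exp_le_exp.2 (by linarith)

lemma exp_expIntegralEin_le_of_one_le {s : ℝ} (hs : 1 ≤ s) :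
    Real.exp (expIntegralEin s) ≤ Real.exp 1 * s := by
  have := expIntegralEin_le_of_le zero_le_one hs (g := Real.log) (g' := fun x => x⁻¹)
    (Real.continuousOn_log.mono fun x hx => (zero_lt_one.trans_le hx.1).ne')
    (fun x hx => Real.hasDerivAt_log (zero_lt_one.trans hx.1).ne') (fun x hx => by
      have hx0 : 0 < x := zero_lt_one.trans hx.1
      rw [← one_div]
      gcongr
      linarith [Real.exp_pos (-x)])
  have h1 := Real.exp_le_exp.1 (exp_expIntegralEin_le_of_le_one zero_le_one le_rfl)
  rw [Real.log_one] at this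
  calc Real.exp (expIntegralEin s) ≤ Real.exp (1 + Real.log s) :=
        Real.exp_le_exp.2 (by linarith)
    _ = Real.exp 1 * s := by rw [Real.exp_add, Real.exp_log (by linarith)]

lemma integral_exp_neg_mul_log :
    ∫ t in Set.Ioi (0:ℝ), Real.exp (-t) * Real.log t = -Real.eulerMascheroniConstant := by
  have h := Complex.hasDerivAt_GammaIntegral (s := 1) (by simp)
  have hev : Complex.Gamma =ᶠ[𝓝 1] Complex.GammaIntegral := by
    have : {s : ℂ | 0 < s.re} ∈ 𝓝 (1:ℂ) :=
      (isOpen_lt continuous_const Complex.continuous_re).mem_nhds (by simp)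
    filter_upwards [this] with s hs
    exact Complex.Gamma_eq_integral hs
  have h' := (h.congr_of_eventuallyEq hev).unique Complex.hasDerivAt_Gamma_one
  have e : ∀ t : ℝ, (t:ℂ) ^ ((1:ℂ) - 1) * ((Real.log t : ℂ) * (Real.exp (-t) : ℂ)) =
      ((Real.exp (-t) * Real.log t : ℝ) : ℂ) := by
    intro t
    rw [sub_self, Complex.cpow_zero]
    push_cast
    ring
  simp only [e] at h'
  rw [integral_complex_ofReal] at h'
  exact_mod_cast h'

lemma integrableOn_exp_neg_mul_log :
    IntegrableOn (fun t => Real.exp (-t) * Real.log t) (Set.Ioi 0) := by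
  by_contra hn
  have h := integral_exp_neg_mul_log
  rw [integral_undef hn] at h
  linarith [Real.one_half_lt_eulerMascheroniConstant]

lemma tendsto_expIntegralEin_sub_log :
    Tendsto (fun s => expIntegralEin s - Real.log s) atTop (𝓝 Real.eulerMascheroniConstant) := by
  have h1 := intervalIntegral_tendsto_integral_Ioi 0 integrableOn_exp_neg_mul_log tendsto_id
  rw [integral_exp_neg_mul_log] at h1
  have h2 : Tendsto (fun s => Real.exp (-s) * Real.log s) atTop (𝓝 0) := by
    have h3 : Tendsto (fun s : ℝ => s * Real.exp (-s)) atTop (𝓝 0) := by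
      simpa using Real.tendsto_pow_mul_exp_neg_atTop_nhds_zero 1
    refine tendsto_of_tendsto_of_tendsto_of_le_of_le' tendsto_const_nhds h3 ?_ ?_ <;>
      filter_upwards [eventually_ge_atTop 1] with s hs
    · exact mul_nonneg (Real.exp_pos _).le (Real.log_nonneg hs)
    · rw [mul_comm]
      gcongr
      exact Real.log_le_self (by linarith)
  have := h2.neg.sub h1
  simp only [neg_zero, zero_sub, neg_neg] at this
  refine this.congr fun s => ?_
  simp only [expIntegralEin, id]
  ring

/-- The Laplace transform of `f` restricted to `[0, U]`. -/
noncomputable def truncatedLaplace (U : ℝ) (f : ℝ → ℝ) (s : ℝ) : ℝ :=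
  ∫ u in (0:ℝ)..U, f u * Real.exp (-(s * u))

namespace IsDelayProfile

variable {δ U : ℝ} {f : ℝ → ℝ}

lemma continuous_truncatedLaplace (h : IsDelayProfile δ U f) :
    Continuous (truncatedLaplace U f) := by
  have := h.continuous
  exact continuous_parametric_intervalIntegral_of_continuous' (by fun_prop) 0 U

lemma hasDerivAt_truncatedLaplace (h : IsDelayProfile δ U f) (hδ : 0 ≤ δ) {s : ℝ} (hs : 0 < s) :
    HasDerivAt (truncatedLaplace U f) (-∫ u in (0:ℝ)..U, u * f u * Real.exp (-(s * u))) s := by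
  have hc := h.continuous
  have hU := h.one_lt
  rw [← intervalIntegral.integral_neg]
  refine (hasDerivAt_integral_of_dominated_loc_of_deriv_le (bound := fun _ => U)
    (F := fun s u => f u * Real.exp (-(s * u))) (F' := fun s u => -(u * f u * Real.exp (-(s * u))))
    (Ioi_mem_nhds hs) ?_ ?_ ?_ ?_ intervalIntegrable_const ?_).2
  · exact Eventually.of_forall fun x => (by fun_prop : Continuous _).aestronglyMeasurable
  · exact (by fun_prop : Continuous _).intervalIntegrable _ _
  · exact (by fun_prop : Continuous _).aestronglyMeasurable
  · refine ae_of_all _ fun u hu x hx => ?_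
    rw [Set.uIoc_of_le (by linarith)] at hu
    have hx' : 0 < x := hx
    have h0 := h.nonneg hu.2
    have h1 := h.le_one hδ hu.2
    have h2 : Real.exp (-(x * u)) ≤ 1 := Real.exp_le_one_iff.2 (by nlinarith [hu.1])
    rw [norm_neg, Real.norm_eq_abs, abs_of_nonneg
      (mul_nonneg (mul_nonneg hu.1.le h0) (Real.exp_pos _).le)]
    calc u * f u * Real.exp (-(x * u)) ≤ U * 1 * 1 := by
          gcongr
          exact hu.2
      _ = U := by ring
  · refine ae_of_all _ fun u _ x _ => ?_
    have : HasDerivAt (fun x : ℝ => -(x * u)) (-u) x := by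
      simpa using ((hasDerivAt_id x).mul_const u).fun_neg
    refine (this.exp.const_mul (f u)).congr_deriv ?_
    ring

lemma mul_integral_id_mul (h : IsDelayProfile δ U f) (s : ℝ) :
    s * ∫ u in (0:ℝ)..U, u * f u * Real.exp (-(s * u)) = truncatedLaplace U f s -
      (1 + δ) * ∫ v in (0:ℝ)..(U - 1), f v * Real.exp (-(s * (v + 1))) := by
  have hc := h.continuous
  have he : ∀ u, HasDerivAt (fun u : ℝ => Real.exp (-(s * u))) (Real.exp (-(s * u)) * (-s)) u := by
    intro u
    refine HasDerivAt.exp ?_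
    simpa using ((hasDerivAt_id u).const_mul s).fun_neg
  have i1 : ∀ a b, IntervalIntegrable (fun u => f u * Real.exp (-(s * u))) volume a b :=
    fun a b => (by fun_prop : Continuous _).intervalIntegrable a b
  have i2 : ∀ a b, IntervalIntegrable (fun u => s * (u * f u * Real.exp (-(s * u)))) volume a b :=
    fun a b => (by fun_prop : Continuous _).intervalIntegrable a b
  have i3 : ∀ a b, IntervalIntegrable (fun u => (1 + δ) * (f (u - 1) * Real.exp (-(s * u))))
      volume a b := fun a b => (by fun_prop : Continuous _).intervalIntegrable a b
  have A := integral_eq_sub_of_hasDerivAt_of_le (f := fun u => u * f u * Real.exp (-(s * u)))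
    (f' := fun u => f u * Real.exp (-(s * u)) - s * (u * f u * Real.exp (-(s * u))))
    zero_le_one (by fun_prop) (fun x hx => by
      refine (((hasDerivAt_id x).mul (h.hasDerivAt_of_lt_one hx.2)).mul (he x)).congr_deriv ?_
      simp only [Pi.mul_apply, id]
      ring) ((i1 _ _).sub (i2 _ _))
  have B := integral_eq_sub_of_hasDerivAt_of_le (f := fun u => u * f u * Real.exp (-(s * u)))
    (f' := fun u => f u * Real.exp (-(s * u)) - s * (u * f u * Real.exp (-(s * u))) -
      (1 + δ) * (f (u - 1) * Real.exp (-(s * u))))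
    h.one_lt.le (by fun_prop) (fun x hx => by
      refine (((hasDerivAt_id x).mul (h.hasDerivAt hx.1)).mul (he x)).congr_deriv ?_
      have : x ≠ 0 := by linarith [hx.1]
      simp only [Pi.mul_apply, id]
      field_simp
      ring) (((i1 _ _).sub (i2 _ _)).sub (i3 _ _))
  rw [intervalIntegral.integral_sub (i1 _ _) (i2 _ _)] at A
  rw [intervalIntegral.integral_sub ((i1 _ _).sub (i2 _ _)) (i3 _ _),
    intervalIntegral.integral_sub (i1 _ _) (i2 _ _)] at B
  have C := integral_comp_sub_right (a := 1) (b := U)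
    (fun v => f v * Real.exp (-(s * (v + 1)))) 1
  simp only [sub_add_cancel, sub_self] at C
  have a1 := integral_add_adjacent_intervals (i1 0 1) (i1 1 U)
  have a2 := integral_add_adjacent_intervals (i2 0 1) (i2 1 U)
  simp only [h.eq_zero, intervalIntegral.integral_const_mul] at A B a2
  rw [C] at B
  unfold truncatedLaplace
  linarith

lemma shifted_laplace_bounds (h : IsDelayProfile δ U f) {a b s : ℝ} (ha : 0 ≤ a) (hab : a ≤ b)
    (hb : b ≤ U) (hs : 0 ≤ s) :
    0 ≤ (∫ v in a..b, f v * Real.exp (-(s * (v + 1)))) ∧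
    (∫ v in a..b, f v * Real.exp (-(s * (v + 1)))) ≤ Real.exp (-s) * ∫ v in a..b, f v ∧
    (1 - s * (U + 1)) * (∫ v in a..b, f v) ≤ ∫ v in a..b, f v * Real.exp (-(s * (v + 1))) := by
  have hc := h.continuous
  have hi : IntervalIntegrable (fun v => f v * Real.exp (-(s * (v + 1)))) volume a b :=
    (by fun_prop : Continuous _).intervalIntegrable a b
  have h0 : ∀ v ∈ Set.Icc a b, 0 ≤ f v := fun v hv => h.nonneg (hv.2.trans hb)
  refine ⟨integral_nonneg hab fun v hv => mul_nonneg (h0 v hv) (Real.exp_pos _).le, ?_, ?_⟩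
  · rw [← intervalIntegral.integral_const_mul]
    refine integral_mono_on hab hi ((by fun_prop : Continuous _).intervalIntegrable a b)
      fun v hv => ?_
    rw [mul_comm]
    refine mul_le_mul_of_nonneg_right (Real.exp_le_exp.2 ?_) (h0 v hv)
    nlinarith [hv.1]
  · rw [← intervalIntegral.integral_const_mul]
    refine integral_mono_on hab ((by fun_prop : Continuous _).intervalIntegrable a b) hi
      fun v hv => ?_
    rw [mul_comm]
    refine mul_le_mul_of_nonneg_left ?_ (h0 v hv)
    nlinarith [Real.add_one_le_exp (-(s * (v + 1))), hv.2.trans hb]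

/-- The derivative of `s ↦ F(s) exp(Ein(s))`, where `F` is the Laplace transform of `f` on
`[0, U]`, is `O(δ U e^{-s})`. -/
lemma exists_hasDerivAt_laplace_mul_exp (h : IsDelayProfile δ U f) (hδ : 0 ≤ δ) {s : ℝ} (hs : 0 < s) :
    ∃ G', HasDerivAt (fun s => truncatedLaplace U f s * Real.exp (expIntegralEin s)) G' s ∧
      |G'| ≤ Real.exp 1 ^ 2 * (U + 1) * (4 * δ) * Real.exp (-s) := by
  have hU := h.one_lt
  have hc := h.continuous
  refine ⟨_, (h.hasDerivAt_truncatedLaplace hδ hs).mul (hasDerivAt_expIntegralEin hs).exp, ?_⟩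
  set P := ∫ v in (0:ℝ)..(U - 1), f v * Real.exp (-(s * (v + 1))) with hP
  set Q := ∫ v in (U - 1)..U, f v * Real.exp (-(s * (v + 1))) with hQ
  set P₀ := ∫ v in (0:ℝ)..(U - 1), f v with hP₀
  set Q₀ := ∫ v in (U - 1)..U, f v with hQ₀
  have hPQ : Real.exp (-s) * truncatedLaplace U f s = P + Q := by
    rw [hP, hQ, integral_add_adjacent_intervals
      ((by fun_prop : Continuous _).intervalIntegrable _ _)
      ((by fun_prop : Continuous _).intervalIntegrable _ _), truncatedLaplace,
      ← intervalIntegral.integral_const_mul]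
    refine integral_congr fun v _ => ?_
    have : Real.exp (-(s * (v + 1))) = Real.exp (-s) * Real.exp (-(s * v)) := by
      rw [← Real.exp_add]
      ring_nf
    rw [this]
    ring
  have hadd : P₀ + Q₀ = ∫ v in (0:ℝ)..U, f v := integral_add_adjacent_intervals
    (hc.intervalIntegrable _ _) (hc.intervalIntegrable _ _)
  have hQδ : Q₀ = δ * P₀ := by
    have := h.integral_eq
    linarith
  have hP₀4 : P₀ ≤ 4 := by
    have h1 := h.integral_le hδ
    have h2 : 0 ≤ Q₀ := integral_nonneg (by linarith) fun v hv => h.nonneg hv.2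
    linarith
  obtain ⟨p1, p2, p3⟩ := h.shifted_laplace_bounds (a := 0) (b := U - 1) le_rfl (by linarith)
    (by linarith) hs.le
  obtain ⟨q1, q2, q3⟩ := h.shifted_laplace_bounds (a := U - 1) (b := U) (by linarith)
    (by linarith) le_rfl hs.le
  rw [← hP, ← hP₀] at p2 p3
  rw [← hP] at p1
  rw [← hQ, ← hQ₀, hQδ] at q2 q3
  rw [← hQ] at q1
  have hE := Real.exp_pos (-s)
  have hE1 : Real.exp (-s) ≤ 1 := Real.exp_le_one_iff.2 (by linarith)
  have hP₀0 : 0 ≤ P₀ := integral_nonneg (by linarith) fun v hv => h.nonneg (by linarith [hv.2])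
  have hδP : δ * P₀ ≤ 4 * δ := by nlinarith
  have hδP0 : 0 ≤ δ * P₀ := by positivity
  have b1 : |δ * P - Q| ≤ Real.exp (-s) * (4 * δ) := by
    have c1 : δ * P ≤ δ * (Real.exp (-s) * P₀) := mul_le_mul_of_nonneg_left p2 hδ
    have c2 : 0 ≤ δ * P := by positivity
    have c3 : Real.exp (-s) * (δ * P₀) ≤ Real.exp (-s) * (4 * δ) :=
      mul_le_mul_of_nonneg_left hδP hE.le
    rw [_root_.abs_le]
    constructor <;> nlinarith
  have b2 : |δ * P - Q| ≤ s * (U + 1) * (4 * δ) := by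
    have c1 : δ * P ≤ δ * P₀ :=
      mul_le_mul_of_nonneg_left (p2.trans (mul_le_of_le_one_left hP₀0 hE1)) hδ
    have c2 : δ * ((1 - s * (U + 1)) * P₀) ≤ δ * P := mul_le_mul_of_nonneg_left p3 hδ
    have c3 : s * (U + 1) * (δ * P₀) ≤ s * (U + 1) * (4 * δ) :=
      mul_le_mul_of_nonneg_left hδP (by positivity)
    have c4 : Q ≤ δ * P₀ := q2.trans (mul_le_of_le_one_left hδP0 hE1)
    rw [_root_.abs_le]
    constructor <;> nlinarith
  set T := ∫ u in (0:ℝ)..U, u * f u * Real.exp (-(s * u)) with hT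
  have hTeq : s * T = truncatedLaplace U f s - (1 + δ) * P := h.mul_integral_id_mul s
  have hG : -T * Real.exp (expIntegralEin s) + truncatedLaplace U f s *
      (Real.exp (expIntegralEin s) * ((1 - Real.exp (-s)) / s)) =
      Real.exp (expIntegralEin s) / s * (δ * P - Q) := by
    have : δ * P - Q = -(s * T) + (1 - Real.exp (-s)) * truncatedLaplace U f s := by
      linarith
    rw [this]
    field_simp
  rw [hG, abs_mul, abs_of_nonneg (by positivity)]
  have he1 : 1 ≤ Real.exp 1 := Real.one_le_exp zero_le_one
  rcases le_total s 1 with hs1 | hs1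
  · have d1 := exp_expIntegralEin_le_of_le_one hs.le hs1
    have d2 : 1 ≤ Real.exp 1 * Real.exp (-s) := by
      rw [← Real.exp_add]
      exact Real.one_le_exp (by linarith)
    calc Real.exp (expIntegralEin s) / s * |δ * P - Q|
        ≤ Real.exp 1 / s * (s * (U + 1) * (4 * δ)) := by gcongr
      _ = Real.exp 1 * (U + 1) * (4 * δ) * 1 := by field_simp
      _ ≤ Real.exp 1 * (U + 1) * (4 * δ) * (Real.exp 1 * Real.exp (-s)) := by gcongr
      _ = _ := by ring
  · have d1 := exp_expIntegralEin_le_of_one_le hs1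
    calc Real.exp (expIntegralEin s) / s * |δ * P - Q|
        ≤ (Real.exp 1 * s) / s * (Real.exp (-s) * (4 * δ)) := by gcongr
      _ = Real.exp 1 * 1 * 1 * (4 * δ) * Real.exp (-s) := by field_simp
      _ ≤ Real.exp 1 * Real.exp 1 * (U + 1) * (4 * δ) * Real.exp (-s) := by
          gcongr
          linarith
      _ = _ := by ring

lemma tendsto_mul_truncatedLaplace (h : IsDelayProfile δ U f) (hδ : 0 ≤ δ) :
    Tendsto (fun s => s * truncatedLaplace U f s) atTop (𝓝 1) := by
  have hc := h.continuous
  have hU := h.one_lt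
  have hint : ∀ b s : ℝ, 0 < s → s * ∫ u in (0:ℝ)..b, Real.exp (-(s * u)) =
      1 - Real.exp (-(s * b)) := by
    intro b s hs
    have := integral_comp_mul_left (a := 0) (b := b) (fun x => Real.exp (-x)) hs.ne'
    rw [this, integral_comp_neg (fun x => Real.exp x), integral_exp]
    simp only [smul_eq_mul, mul_zero, neg_zero, Real.exp_zero]
    field_simp
  have hI : ∀ a b s, IntervalIntegrable (fun u => f u * Real.exp (-(s * u))) volume a b :=
    fun a b s => (by fun_prop : Continuous _).intervalIntegrable a b
  have hI' : ∀ a b s, IntervalIntegrable (fun u : ℝ => Real.exp (-(s * u))) volume a b :=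
    fun a b s => (by fun_prop : Continuous _).intervalIntegrable a b
  have hlim : Tendsto (fun s : ℝ => 1 - Real.exp (-s)) atTop (𝓝 1) := by
    simpa using Real.tendsto_exp_neg_atTop_nhds_zero.const_sub 1
  refine tendsto_of_tendsto_of_tendsto_of_le_of_le' hlim tendsto_const_nhds ?_ ?_ <;>
    filter_upwards [eventually_gt_atTop 0] with s hs
  · have e1 := hint 1 s hs
    rw [mul_one] at e1
    rw [← e1]
    refine mul_le_mul_of_nonneg_left ?_ hs.le
    rw [truncatedLaplace, ← integral_add_adjacent_intervals (hI 0 1 s) (hI 1 U s)]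
    have e2 : ∫ u in (0:ℝ)..1, f u * Real.exp (-(s * u)) = ∫ u in (0:ℝ)..1, Real.exp (-(s * u)) := by
      refine integral_congr fun u hu => ?_
      rw [Set.uIcc_of_le zero_le_one] at hu
      rw [h.eq_one u hu.2, one_mul]
    have e3 : 0 ≤ ∫ u in (1:ℝ)..U, f u * Real.exp (-(s * u)) :=
      integral_nonneg hU.le fun u hu => mul_nonneg (h.nonneg hu.2) (Real.exp_pos _).le
    linarith
  · have e1 : truncatedLaplace U f s ≤ ∫ u in (0:ℝ)..U, Real.exp (-(s * u)) :=
      integral_mono_on (by linarith) (hI _ _ _) (hI' _ _ _) fun u hu =>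
        mul_le_of_le_one_left (Real.exp_pos _).le (h.le_one hδ hu.2)
    have e2 := mul_le_mul_of_nonneg_left e1 hs.le
    rw [hint U s hs] at e2
    linarith [Real.exp_pos (-(s * U))]

lemma abs_integral_sub_exp_le (h : IsDelayProfile δ U f) (hδ : 0 ≤ δ) :
    |(∫ t in (0:ℝ)..U, f t) - Real.exp Real.eulerMascheroniConstant| ≤
      Real.exp 1 ^ 2 * (U + 1) * (4 * δ) := by
  set A := Real.exp 1 ^ 2 * (U + 1) * (4 * δ) with hA
  have hA0 : 0 ≤ A := by
    have := h.one_lt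
    positivity
  set G : ℝ → ℝ := fun s => truncatedLaplace U f s * Real.exp (expIntegralEin s) with hG
  have hGc : Continuous G :=
    h.continuous_truncatedLaplace.mul (Real.continuous_exp.comp continuous_expIntegralEin)
  have hG0 : G 0 = ∫ t in (0:ℝ)..U, f t := by simp [hG, expIntegralEin_zero, truncatedLaplace]
  have hexp : ∀ s : ℝ, HasDerivAt (fun s => A * Real.exp (-s)) (-(A * Real.exp (-s))) s := by
    intro s
    simpa using ((hasDerivAt_neg s).exp).const_mul A
  have hanti : AntitoneOn (fun s => G s + A * Real.exp (-s)) (Set.Ici 0) := by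
    refine antitoneOn_of_deriv_nonpos (convex_Ici 0)
      (hGc.add (by fun_prop)).continuousOn ?_ ?_ <;> rw [interior_Ici] <;> intro s hs
    · obtain ⟨G', hd, -⟩ := h.exists_hasDerivAt_laplace_mul_exp hδ hs
      exact (hd.add (hexp s)).differentiableAt.differentiableWithinAt
    · obtain ⟨G', hd, hb⟩ := h.exists_hasDerivAt_laplace_mul_exp hδ hs
      rw [(hd.fun_add (hexp s)).deriv]
      linarith [(_root_.abs_le.1 hb).2]
  have hmono : MonotoneOn (fun s => G s - A * Real.exp (-s)) (Set.Ici 0) := by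
    refine monotoneOn_of_deriv_nonneg (convex_Ici 0)
      (hGc.sub (by fun_prop)).continuousOn ?_ ?_ <;> rw [interior_Ici] <;> intro s hs
    · obtain ⟨G', hd, -⟩ := h.exists_hasDerivAt_laplace_mul_exp hδ hs
      exact (hd.sub (hexp s)).differentiableAt.differentiableWithinAt
    · obtain ⟨G', hd, hb⟩ := h.exists_hasDerivAt_laplace_mul_exp hδ hs
      rw [(hd.fun_sub (hexp s)).deriv]
      linarith [(_root_.abs_le.1 hb).1]
  have hlim : Tendsto G atTop (𝓝 (Real.exp Real.eulerMascheroniConstant)) := by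
    have := (h.tendsto_mul_truncatedLaplace hδ).mul
      ((Real.continuous_exp.tendsto _).comp tendsto_expIntegralEin_sub_log)
    rw [one_mul] at this
    refine this.congr' ?_
    filter_upwards [eventually_gt_atTop 0] with s hs
    simp only [Function.comp, hG, Real.exp_sub, Real.exp_log hs]
    field_simp
  have hbd : ∀ s, 0 ≤ s → |G 0 - G s| ≤ A := by
    intro s hs
    have h1 := hanti Set.self_mem_Ici hs hs
    have h2 := hmono Set.self_mem_Ici hs hs
    have h3 : 0 ≤ A * Real.exp (-s) := by positivity
    simp only [neg_zero, Real.exp_zero, mul_one] at h1 h2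
    rw [_root_.abs_le]
    constructor <;> linarith
  rw [← hG0]
  refine le_of_tendsto (hlim.const_sub (G 0)).abs ?_
  filter_upwards [eventually_ge_atTop 0] with s hs using hbd s hs

end IsDelayProfile

lemma exists_integral_sub_exp_bound :
    ∃ C > (0:ℝ), ∃ δ₀ > (0:ℝ), ∀ δ : ℝ, 0 < δ → δ ≤ δ₀ →
      ∀ σδ : ℝ → ℝ, IsDeltaSolution δ σδ → ∀ U : ℝ, IsSmallestPosZero σδ U →
        |(1 / U) * (∫ t in (0:ℝ)..U, σδ t)
            - Real.exp Real.eulerMascheroniConstant / U| ≤ C * δ := by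
  refine ⟨8 * Real.exp 1 ^ 2, by positivity, 1, one_pos, fun δ hδ _ σ hσ U hU => ?_⟩
  have h := hσ.isDelayProfile hU
  have hb := h.abs_integral_sub_exp_le hδ.le
  have hU1 := h.one_lt
  have e : ∫ t in (0:ℝ)..U, σ (max t 0) = ∫ t in (0:ℝ)..U, σ t := by
    refine integral_congr fun t ht => ?_
    rw [Set.uIcc_of_le (by linarith)] at ht
    rw [max_eq_left ht.1]
  rw [e] at hb
  have hU0 : 0 < U := by linarith
  rw [one_div_mul_eq_div, ← sub_div, abs_div, abs_of_pos hU0, div_le_iff₀ hU0]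
  refine hb.trans ?_
  have : 0 ≤ Real.exp 1 ^ 2 * δ := by positivity
  nlinarith

theorem prop2_construction :
    (∀ δ : ℝ, 0 < δ → δ ≤ 1 → ∀ σδ : ℝ → ℝ, IsDeltaSolution δ σδ →
      ∀ U : ℝ, IsSmallestPosZero σδ U →
        ∃ χ σ : ℝ → ℝ, Measurable χ ∧
          (∀ t : ℝ, 0 ≤ t → χ t ∈ Set.Icc (-δ) 1) ∧
          (∀ t : ℝ, 0 ≤ t → t ≤ 1 → χ t = 1) ∧
          (∀ t : ℝ, 1 < t → t ≤ U → χ t = -δ) ∧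
          ContinuousOn χ (Set.Ioi U) ∧
          ContinuousOn σ (Set.Ici 0) ∧
          (∀ u : ℝ, 0 ≤ u → u ≤ 1 → σ u = 1) ∧
          (∀ u : ℝ, 1 < u → u * σ u = ∫ t in (0:ℝ)..u, σ (u - t) * χ t) ∧
          (∀ u : ℝ, 0 ≤ u → u ≤ U → σ u = σδ u) ∧
          (∀ u : ℝ, U ≤ u → σ u = 0)) ∧
    (∃ C > (0:ℝ), ∃ δ₀ > (0:ℝ), ∀ δ : ℝ, 0 < δ → δ ≤ δ₀ →
      ∀ σδ : ℝ → ℝ, IsDeltaSolution δ σδ → ∀ U : ℝ, IsSmallestPosZero σδ U →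
        |(1 / U) * (∫ t in (0:ℝ)..U, σδ t)
            - Real.exp Real.eulerMascheroniConstant / U| ≤ C * δ) := by
  exact ⟨fun δ hδ0 hδ σδ hσ U hU => exists_multiplier_vanishing_solution hδ0 hδ hσ hU,
    exists_integral_sub_exp_bound⟩
end
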